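/- arXiv:math/0404496 — 7 statements merged into one kernel-verified Lean document; each statement's English description precedes it below -/
import Mathlib

section
/- Let G5 → G4 → G3 → G2 → G1 (maps α5, α4, α3, α2) and H5 → H4 → H3 → H2 → H1 (maps β5, β4, β3, β2) be sequences of pointed sets and pointed maps, each exact at the three middle spots, and let γi : Gi → Hi (i = 1,…,5) be pointed maps making every square commute (γ ∘ α = β ∘ γ). Suppose moreover that G3 and G2 are groups whose basepoints are the identity elements, that α3 : G3 → G2 is a group homomorphism, that H3 carries a G3-action and H2 carries a G2-action such that γ3(g) = g • (basepoint of H3) for all g ∈ G3 and γ2(g) = g • (basepoint of H2) for all g ∈ G2, and that β3 is equivariant in the sense that β3(g • h) = α3(g) • β3(h) for all g ∈ G3, h ∈ H3. If γ1, γ2, γ4 and γ5 are bijections, then γ3 is a bijection. -/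
/-- A non-traditional 5-lemma for pointed sets: given two 5-term sequences of
pointed sets, exact at the three middle spots, connected by pointed maps
`γ1, …, γ5` making all squares commute, where `G3`, `G2` are groups (with the
identity as basepoint), `α3` is a group homomorphism, `H3` is a `G3`-set and
`H2` a `G2`-set with `γ3 g = g • h3₀`, `γ2 g = g • h2₀`, and `β3` is
equivariant over `α3`, if `γ1`, `γ2`, `γ4`, `γ5` are bijections then so is `γ3`. -/
theorem stmt_0 {G1 G2 G3 G4 G5 H1 H2 H3 H4 H5 : Type*}
    [Group G2] [Group G3] [MulAction G2 H2] [MulAction G3 H3]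
    -- basepoints (those of `G2`, `G3` are the identity elements)
    (g1₀ : G1) (g4₀ : G4) (g5₀ : G5)
    (h1₀ : H1) (h2₀ : H2) (h3₀ : H3) (h4₀ : H4) (h5₀ : H5)
    -- the two rows
    (α5 : G5 → G4) (α4 : G4 → G3) (α3 : G3 →* G2) (α2 : G2 → G1)
    (β5 : H5 → H4) (β4 : H4 → H3) (β3 : H3 → H2) (β2 : H2 → H1)
    -- the vertical maps
    (γ1 : G1 → H1) (γ2 : G2 → H2) (γ3 : G3 → H3) (γ4 : G4 → H4) (γ5 : G5 → H5)
    -- all maps are pointed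
    (hα5 : α5 g5₀ = g4₀) (hα4 : α4 g4₀ = 1) (hα2 : α2 1 = g1₀)
    (hβ5 : β5 h5₀ = h4₀) (hβ4 : β4 h4₀ = h3₀) (hβ3 : β3 h3₀ = h2₀)
    (hβ2 : β2 h2₀ = h1₀)
    (hγ5 : γ5 g5₀ = h5₀) (hγ4 : γ4 g4₀ = h4₀) (hγ3 : γ3 1 = h3₀)
    (hγ2 : γ2 1 = h2₀) (hγ1 : γ1 g1₀ = h1₀)
    -- exactness of the top row at `G4`, `G3`, `G2`
    (hexG4 : Set.range α5 = α4 ⁻¹' {(1 : G3)})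
    (hexG3 : Set.range α4 = (α3 : G3 → G2) ⁻¹' {(1 : G2)})
    (hexG2 : Set.range (α3 : G3 → G2) = α2 ⁻¹' {g1₀})
    -- exactness of the bottom row at `H4`, `H3`, `H2`
    (hexH4 : Set.range β5 = β4 ⁻¹' {h3₀})
    (hexH3 : Set.range β4 = β3 ⁻¹' {h2₀})
    (hexH2 : Set.range β3 = β2 ⁻¹' {h1₀})
    -- all squares commute
    (hc5 : ∀ g, γ4 (α5 g) = β5 (γ5 g))
    (hc4 : ∀ g, γ3 (α4 g) = β4 (γ4 g))
    (hc3 : ∀ g, γ2 (α3 g) = β3 (γ3 g))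
    (hc2 : ∀ g, γ1 (α2 g) = β2 (γ2 g))
    -- compatibility of `γ3`, `γ2` with the actions, and equivariance of `β3`
    (hγ3act : ∀ g : G3, γ3 g = g • h3₀)
    (hγ2act : ∀ g : G2, γ2 g = g • h2₀)
    (hβ3equiv : ∀ (g : G3) (h : H3), β3 (g • h) = α3 g • β3 h)
    -- `γ1`, `γ2`, `γ4`, `γ5` are bijections
    (hbij1 : Function.Bijective γ1) (hbij2 : Function.Bijective γ2)
    (hbij4 : Function.Bijective γ4) (hbij5 : Function.Bijective γ5) :
    Function.Bijective γ3 := by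
  have exG4 : ∀ x, α4 x = 1 ↔ ∃ z, α5 z = x := fun x => (Set.ext_iff.mp hexG4 x).symm
  have exG3 : ∀ x, α3 x = 1 ↔ ∃ z, α4 z = x := fun x => (Set.ext_iff.mp hexG3 x).symm
  have exG2 : ∀ x, α2 x = g1₀ ↔ ∃ z, α3 z = x := fun x => (Set.ext_iff.mp hexG2 x).symm
  have exH4 : ∀ x, β4 x = h3₀ ↔ ∃ z, β5 z = x := fun x => (Set.ext_iff.mp hexH4 x).symm
  have exH3 : ∀ x, β3 x = h2₀ ↔ ∃ z, β4 z = x := fun x => (Set.ext_iff.mp hexH3 x).symm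
  have exH2 : ∀ x, β2 x = h1₀ ↔ ∃ z, β3 z = x := fun x => (Set.ext_iff.mp hexH2 x).symm
  have kernel_trivial : ∀ k, γ3 k = h3₀ → k = 1 := by
    intro k hk
    have hα3k : α3 k = 1 := hbij2.1 (by rw [hc3, hk, hβ3, hγ2])
    obtain ⟨x, rfl⟩ := (exG3 k).1 hα3k
    obtain ⟨y, hy⟩ := (exH4 (γ4 x)).1 (by rw [← hc4, hk])
    obtain ⟨z, rfl⟩ := hbij5.2 y
    exact (exG4 x).2 ⟨z, hbij4.1 (by rw [hc5, hy])⟩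
  constructor
  · intro g g' h
    rw [← inv_mul_eq_one]
    apply kernel_trivial
    rw [hγ3act, mul_smul, ← hγ3act g', ← h, hγ3act, inv_smul_smul]
  · intro h
    obtain ⟨a, ha⟩ := hbij2.2 (β3 h)
    obtain ⟨g, rfl⟩ := (exG2 a).1
      (hbij1.1 (by rw [hc2, ha, hγ1]; exact (exH2 _).2 ⟨h, rfl⟩))
    obtain ⟨y, hy⟩ := (exH3 (g⁻¹ • h)).1
      (by rw [hβ3equiv, ← ha, hγ2act, map_inv, inv_smul_smul])
    obtain ⟨x, rfl⟩ := hbij4.2 y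
    refine ⟨g * α4 x, ?_⟩
    rw [hγ3act, mul_smul, ← hγ3act, hc4, hy, smul_inv_smul]
end

section
/- Let E be a 4-dimensional real vector space with a nondegenerate alternating bilinear form ω, and let V, P ⊆ E be two symplectic planes that are complementary (V ∩ P = 0, V + P = E). Let V⊥ denote the ω-orthogonal complement of V (so E = V ⊕ V⊥, since V is symplectic), and let π⊥ : P → V⊥ be the restriction to P of the projection of E onto V⊥ along V. Assume π⊥ does not reverse the ω-induced orientations, i.e. ω(π⊥ p, π⊥ q) ≥ 0 for all p, q ∈ P with ω(p, q) > 0. Fix a complex structure J_P on P that is tame for the restriction of ω to P, and fix a nonzero vector v ∈ V. Then the map Φ_v sending J_V to J_V(v), defined on the set of complex structures J_V on V such that the direct-sum complex structure J_P ⊕ J_V on E is ω-tame (topologized as a subspace of the linear endomorphisms of V), is a topological embedding (injective, a homeomorphism onto its image) and its range is a convex subset of V. -/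
/-- Given complementary symplectic planes `V`, `P` in a 4-dimensional symplectic
vector space `(E, ω)` and a complex structure `JP` on `P`, this is the set of
(continuous) complex structures `JV` on `V` such that the direct-sum complex
structure `JP ⊕ JV` on `E` is `ω`-tame. -/
def tameDirectSum {E : Type*} [NormedAddCommGroup E] [NormedSpace ℝ E]
    (ω : E →ₗ[ℝ] E →ₗ[ℝ] ℝ) (V P : Submodule ℝ E) (hcompl : IsCompl V P)
    (JP : P →ₗ[ℝ] P) : Set (V →L[ℝ] V) :=
  {JV | (∀ y : V, JV (JV y) = -y) ∧
    ∀ x : E, x ≠ 0 →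
      0 < ω x ((JV (V.linearProjOfIsCompl P hcompl x) : E) +
        (JP (P.linearProjOfIsCompl V hcompl.symm x) : E))}

open Topology

section Plane

variable {W : Type*} [AddCommGroup W] [Module ℝ W] {Ω : W →ₗ[ℝ] W →ₗ[ℝ] ℝ}

/-- Three vectors in a plane satisfy the linear relation given by an alternating form. -/
lemma LinearMap.IsAlt.smul_eq_of_finrank_eq_two (hΩ : Ω.IsAlt)
    (hW : Module.finrank ℝ W = 2) (v z u : W) :
    Ω v z • u = Ω u z • v + Ω v u • z := by
  have : Module.Finite ℝ W := Module.finite_of_finrank_eq_succ hW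
  let e := Module.finBasisOfFinrankEq ℝ W hW
  have hrepr (x : W) : ∃ s t : ℝ, x = s • e 0 + t • e 1 :=
    ⟨e.repr x 0, e.repr x 1, by rw [← Fin.sum_univ_two (f := fun i => e.repr x i • e i), e.sum_repr]⟩
  obtain ⟨v₀, v₁, rfl⟩ := hrepr v
  obtain ⟨z₀, z₁, rfl⟩ := hrepr z
  obtain ⟨u₀, u₁, rfl⟩ := hrepr u
  have h₁₀ : Ω (e 1) (e 0) = -Ω (e 0) (e 1) := by rw [hΩ.neg]
  simp only [map_add, map_smul, LinearMap.add_apply, LinearMap.smul_apply, hΩ.self_eq_zero, h₁₀, smul_eq_mul]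
  module

/-- The linear endomorphism sending `v` to `z` and `z` to `-v`, when `W` is a plane and
`Ω v z ≠ 0`. -/
noncomputable def rotationOfImage (Ω : W →ₗ[ℝ] W →ₗ[ℝ] ℝ) (v z : W) : W →ₗ[ℝ] W :=
  (Ω v z)⁻¹ • ((Ω.flip z).smulRight z + (Ω.flip v).smulRight v)

lemma rotationOfImage_apply (v z u : W) :
    rotationOfImage Ω v z u = (Ω v z)⁻¹ • (Ω u z • z + Ω u v • v) := by
  simp [rotationOfImage]

lemma rotationOfImage_left (hΩ : Ω.IsAlt) {v z : W} (h : Ω v z ≠ 0) :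
    rotationOfImage Ω v z v = z := by
  simp [rotationOfImage_apply, hΩ.self_eq_zero, smul_smul, h]

lemma rotationOfImage_right (hΩ : Ω.IsAlt) {v z : W} (h : Ω v z ≠ 0) :
    rotationOfImage Ω v z z = -v := by
  simp [rotationOfImage_apply, hΩ.self_eq_zero, smul_smul, ← hΩ.neg v z, h]

lemma rotationOfImage_rotationOfImage (hΩ : Ω.IsAlt) (hW : Module.finrank ℝ W = 2)
    {v z : W} (h : Ω v z ≠ 0) (u : W) :
    rotationOfImage Ω v z (rotationOfImage Ω v z u) = -u := by
  apply smul_right_injective W h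
  simp only [← map_smul, smul_neg]
  rw [hΩ.smul_eq_of_finrank_eq_two hW v z u]
  simp only [map_add, map_smul, rotationOfImage_left hΩ h, rotationOfImage_right hΩ h, map_neg]
  module

/-- A complex structure on a plane is determined by its value at a vector. -/
lemma eq_rotationOfImage (hΩ : Ω.IsAlt) (hW : Module.finrank ℝ W = 2) {J : W →ₗ[ℝ] W}
    (hJ : ∀ u, J (J u) = -u) {v : W} (h : Ω v (J v) ≠ 0) :
    J = rotationOfImage Ω v (J v) := by
  ext u
  apply smul_right_injective W h
  simp only [rotationOfImage_apply, smul_inv_smul₀ h]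
  rw [← map_smul, hΩ.smul_eq_of_finrank_eq_two hW v (J v) u, ← hΩ.neg v u]
  simp [hJ]

lemma apply_rotationOfImage_self (v z u : W) :
    Ω u (rotationOfImage Ω v z u) = (Ω v z)⁻¹ * (Ω u z ^ 2 + Ω u v ^ 2) := by
  simp only [rotationOfImage_apply, map_smul, map_add, smul_eq_mul]
  ring

lemma rotationOfImage_pos (hΩ : Ω.IsAlt) (hW : Module.finrank ℝ W = 2)
    {v z : W} (h : 0 < Ω v z) {u : W} (hu : u ≠ 0) :
    0 < Ω u (rotationOfImage Ω v z u) := by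
  rw [apply_rotationOfImage_self]
  refine mul_pos (inv_pos.2 h) ((by positivity : 0 ≤ Ω u z ^ 2 + Ω u v ^ 2).lt_of_ne' ?_)
  intro h₀
  have hz : Ω u z = 0 := by nlinarith [sq_nonneg (Ω u v)]
  have hv : Ω v u = 0 := by rw [← hΩ.neg u v]; nlinarith [sq_nonneg (Ω u z)]
  have := hΩ.smul_eq_of_finrank_eq_two hW v z u
  simp [hz, hv, h.ne', hu] at this

/-- A rotation of a plane preserves the area form. -/
lemma apply_rotationOfImage_rotationOfImage (hΩ : Ω.IsAlt) (hW : Module.finrank ℝ W = 2)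
    {v z : W} (h : Ω v z ≠ 0) (u w : W) :
    Ω (rotationOfImage Ω v z u) (rotationOfImage Ω v z w) = Ω u w := by
  have hrel := congrArg (fun x => Ω x w) (hΩ.smul_eq_of_finrank_eq_two hW v z u)
  simp only [map_add, map_smul, LinearMap.add_apply, LinearMap.smul_apply, smul_eq_mul] at hrel
  simp only [rotationOfImage_apply, map_add, map_smul, LinearMap.add_apply, LinearMap.smul_apply, smul_eq_mul,
    hΩ.self_eq_zero]
  rw [← hΩ.neg v z, ← hΩ.neg v u, ← hΩ.neg v w, ← hΩ.neg z w]
  field_simp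
  linear_combination -(Ω v z) * hrel

/-- The tameness condition for the direct sum of complex structures on a plane `W` and
a plane `P`, in terms of a nonzero vector `p` of `P`. -/
lemma tame_iff {P : Type*} [AddCommGroup P] [Module ℝ P] {β : P →ₗ[ℝ] P →ₗ[ℝ] ℝ}
    (hΩ : Ω.IsAlt) (hβ : β.IsAlt) (hP : Module.finrank ℝ P = 2)
    {J : W →ₗ[ℝ] W} (hJ : ∀ u, J (J u) = -u) (hJΩ : ∀ u w, Ω (J u) (J w) = Ω u w)
    {K : P →ₗ[ℝ] P} (hK : ∀ q, K (K q) = -q) (a : P →ₗ[ℝ] W)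
    {p : P} (hp : 0 < β p (K p)) :
    (∀ (u : W) (q : P), (u ≠ 0 ∨ q ≠ 0) →
      0 < Ω u (J u) + Ω u (a (K q)) + Ω (a q) (J u) + β q (K q)) ↔
    (∀ u, u ≠ 0 → 0 < Ω u (J u)) ∧
      Ω (a p) (J (a p)) + Ω (a (K p)) (J (a (K p))) <
        4 * β p (K p) - 2 * Ω (a p) (a (K p)) := by
  have hsymm (x y : W) : Ω (J x) y = -Ω y (J x) := by rw [hΩ.neg]
  have hcomm (x y : W) : Ω x (J y) = Ω y (J x) := by
    rw [← hJΩ x (J y), hJ, map_neg, hΩ.neg]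
  have key (u : W) (s t : ℝ) :
      4 * (Ω u (J u) + Ω u (a (K (s • p + t • K p))) + Ω (a (s • p + t • K p)) (J u)
        + β (s • p + t • K p) (K (s • p + t • K p))) =
      Ω ((2 : ℝ) • u + (a (s • p + t • K p) - J (a (K (s • p + t • K p)))))
        (J ((2 : ℝ) • u + (a (s • p + t • K p) - J (a (K (s • p + t • K p)))))) +
      (s ^ 2 + t ^ 2) * (4 * β p (K p) - 2 * Ω (a p) (a (K p)) -
        (Ω (a p) (J (a p)) + Ω (a (K p)) (J (a (K p))))) := by
    have hβ' : β (K p) p = -β p (K p) := by rw [hβ.neg]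
    simp only [map_add, map_sub, map_smul, map_neg, hJ, hJΩ, hK, LinearMap.add_apply, LinearMap.sub_apply, LinearMap.smul_apply,
      LinearMap.neg_apply, smul_eq_mul, hβ', hΩ.self_eq_zero, hβ.self_eq_zero, smul_neg]
    simp only [hsymm]
    rw [← hΩ.neg (a p) (a (K p)), hcomm (a (K p)) (a p), hcomm (a p) u, hcomm (a (K p)) u,
      ← hΩ.neg u (a p), ← hΩ.neg u (a (K p))]
    ring
  constructor
  · intro h
    have hpos (u : W) (hu : u ≠ 0) : 0 < Ω u (J u) := by simpa using h u 0 (.inl hu)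
    refine ⟨hpos, ?_⟩
    have hp₀ : p ≠ 0 := by rintro rfl; simp at hp
    have hm := h (-(1 / 2 : ℝ) • (a p - J (a (K p)))) p (.inr hp₀)
    have hk := key (-(1 / 2 : ℝ) • (a p - J (a (K p)))) 1 0
    simp only [one_smul, zero_smul, add_zero, smul_smul] at hk
    norm_num at hk hm
    linarith
  · rintro ⟨hpos, hlt⟩ u q huq
    obtain ⟨s, t, rfl⟩ : ∃ s t : ℝ, q = s • p + t • K p := by
      refine ⟨(β p (K p))⁻¹ * β q (K p), (β p (K p))⁻¹ * β p q, ?_⟩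
      rw [mul_smul, mul_smul, ← smul_add, ← hβ.smul_eq_of_finrank_eq_two hP,
        inv_smul_smul₀ hp.ne']
    have hnonneg (x : W) : 0 ≤ Ω x (J x) := by
      rcases eq_or_ne x 0 with rfl | hx
      · simp
      · exact (hpos x hx).le
    by_cases hst : s ^ 2 + t ^ 2 = 0
    · have hs : s = 0 := by nlinarith [sq_nonneg t]
      have ht : t = 0 := by nlinarith [sq_nonneg s]
      subst hs ht
      simpa using hpos u (by simpa using huq)
    · have hst' : 0 < s ^ 2 + t ^ 2 := (by positivity : 0 ≤ s ^ 2 + t ^ 2).lt_of_ne' hst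
      have := key u s t
      have := mul_pos hst' (sub_pos.2 hlt)
      linarith [hnonneg ((2 : ℝ) • u + (a (s • p + t • K p) - J (a (K (s • p + t • K p)))))]

end Plane

/-- The inequalities describing the images of `v` under tame complex structures are convex. -/
lemma convex_tameImages {W : Type*} [AddCommGroup W] [Module ℝ W]
    (Ω : W →ₗ[ℝ] W →ₗ[ℝ] ℝ) (v b c : W) (k : ℝ) :
    Convex ℝ {z | 0 < Ω v z ∧
      (Ω b z ^ 2 + Ω b v ^ 2) + (Ω c z ^ 2 + Ω c v ^ 2) < k * Ω v z} := by
  rintro x ⟨hx, hx'⟩ y ⟨hy, hy'⟩ s t hs ht hst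
  simp only [Set.mem_ofPred_eq, map_add, map_smul, smul_eq_mul]
  obtain rfl : t = 1 - s := by linarith
  refine ⟨(convex_Ioi (0 : ℝ)) hx hy hs ht hst, ?_⟩
  have := (convex_Ioi (0 : ℝ)) (sub_pos.2 hx') (sub_pos.2 hy') hs ht hst
  simp only [Set.mem_Ioi, smul_eq_mul] at this
  nlinarith [mul_nonneg (mul_nonneg hs ht) (sq_nonneg (Ω b x - Ω b y)),
    mul_nonneg (mul_nonneg hs ht) (sq_nonneg (Ω c x - Ω c y))]

lemma continuous_rotationOfImage {W : Type*} [NormedAddCommGroup W] [NormedSpace ℝ W]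
    [FiniteDimensional ℝ W] (Ω : W →ₗ[ℝ] W →ₗ[ℝ] ℝ) (v : W) :
    Continuous fun z : {z // 0 < Ω v z} => LinearMap.toContinuousLinearMap (rotationOfImage Ω v z) := by
  rw [continuous_clm_apply]
  intro u
  have hΩ (x : W) : Continuous fun z : {z // 0 < Ω v z} => Ω x z :=
    (Ω x).continuous_of_finiteDimensional.comp continuous_subtype_val
  simp only [LinearMap.coe_toContinuousLinearMap', rotationOfImage_apply]
  exact ((hΩ v).inv₀ fun z => z.2.ne').smul
    (((hΩ u).smul continuous_subtype_val).add continuous_const)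

/-- The linear algebra lemma: with `V`, `P` complementary symplectic planes in a
4-dimensional symplectic vector space `(E, ω)`, `pr` the projection onto the
`ω`-orthogonal complement of `V` along `V` (whose restriction to `P` does not
reverse orientations), `JP` a tame complex structure on `P`, and `v ∈ V`
nonzero, the map `Φ_v : JV ↦ JV v`, defined on the set of complex structures
`JV` on `V` for which `JP ⊕ JV` is `ω`-tame, is a topological embedding with
convex range. -/
theorem stmt_1 {E : Type*} [NormedAddCommGroup E] [NormedSpace ℝ E]
    [FiniteDimensional ℝ E] (hdim : Module.finrank ℝ E = 4)
    (ω : E →ₗ[ℝ] E →ₗ[ℝ] ℝ)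
    (halt : ∀ x, ω x x = 0)
    (hnd : ∀ x, (∀ y, ω x y = 0) → x = 0)
    (V P : Submodule ℝ E)
    (hVdim : Module.finrank ℝ V = 2) (hPdim : Module.finrank ℝ P = 2)
    (hVsymp : ∀ x ∈ V, x ≠ 0 → ∃ y ∈ V, ω x y ≠ 0)
    (hPsymp : ∀ x ∈ P, x ≠ 0 → ∃ y ∈ P, ω x y ≠ 0)
    (hcompl : IsCompl V P)
    -- `pr` is the projection of `E` onto `V⊥` (the `ω`-orthogonal complement
    -- of `V`) along `V`
    (pr : E →ₗ[ℝ] E)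
    (hprperp : ∀ x : E, ∀ u ∈ V, ω (pr x) u = 0)
    (hprproj : ∀ x : E, x - pr x ∈ V)
    -- the restriction `π⊥` of `pr` to `P` does not reverse orientations
    (hor : ∀ p ∈ P, ∀ q ∈ P, 0 < ω p q → 0 ≤ ω (pr p) (pr q))
    -- a complex structure on `P`, tame for the restriction of `ω` to `P`
    (JP : P →ₗ[ℝ] P) (hJP : ∀ y : P, JP (JP y) = -y)
    (hJPtame : ∀ y : P, y ≠ 0 → 0 < ω (y : E) (JP y : E))
    (v : V) (hv : v ≠ 0) :
    Topology.IsEmbedding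
      (fun J : tameDirectSum ω V P hcompl JP => (J : V →L[ℝ] V) v) ∧
    Convex ℝ
      (Set.range fun J : tameDirectSum ω V P hcompl JP => (J : V →L[ℝ] V) v) := by
  let Ω : V →ₗ[ℝ] V →ₗ[ℝ] ℝ := ω.domRestrict₁₂ V V
  let β : P →ₗ[ℝ] P →ₗ[ℝ] ℝ := ω.domRestrict₁₂ P P
  let a : P →ₗ[ℝ] V := ((LinearMap.id - pr).comp P.subtype).codRestrict V fun p => hprproj p
  have hΩ : Ω.IsAlt := fun x => halt x
  have hβ : β.IsAlt := fun x => halt x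
  have hω : ω.IsAlt := halt
  have ha_left (q : P) (u : V) : ω q u = Ω (a q) u := by
    change ω q u = ω (q - pr q) u
    simp [hprperp q u u.2]
  have ha_right (u : V) (q : P) : ω u q = Ω u (a q) := by
    rw [← hω.neg, ha_left, hΩ.neg]
  obtain ⟨p, hp⟩ : ∃ p : P, p ≠ 0 := by
    have : Nontrivial P := Module.nontrivial_of_finrank_pos (R := ℝ) (by omega)
    exact exists_ne 0
  have hp' : 0 < β p (JP p) := hJPtame p hp
  have hmem (J : V →L[ℝ] V) : J ∈ tameDirectSum ω V P hcompl JP ↔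
      (∀ y, J (J y) = -y) ∧ ∀ (u : V) (q : P), (u ≠ 0 ∨ q ≠ 0) →
        0 < Ω u (J u) + Ω u (a (JP q)) + Ω (a q) (J u) + β q (JP q) := by
    change (_ ∧ ∀ x : E, x ≠ 0 → 0 < ω x ((J (V.projectionOnto P hcompl x) : E) +
      JP (P.projectionOnto V hcompl.symm x))) ↔ _
    refine and_congr_right fun _ => ?_
    have hexp (u : V) (q : P) : ω (u + q) (J u + JP q) =
        Ω u (J u) + Ω u (a (JP q)) + Ω (a q) (J u) + β q (JP q) := by
      simp only [map_add, LinearMap.add_apply, ha_left, ha_right]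
      change Ω u (J u) + _ + (_ + β q (JP q)) = _
      ring
    constructor
    · intro h u q huq
      have hne : (u + q : E) ≠ 0 := by
        intro h₀
        have hu := congrArg (V.projectionOnto P hcompl) h₀
        have hq := congrArg (P.projectionOnto V hcompl.symm) h₀
        simp at hu hq
        simp [hu, hq] at huq
      have := h _ hne
      rw [map_add (V.projectionOnto P hcompl), map_add (P.projectionOnto V hcompl.symm),
        Submodule.projectionOnto_apply_left, Submodule.projectionOnto_apply_left,
        Submodule.projectionOnto_apply_right, Submodule.projectionOnto_apply_right,
        add_zero, zero_add] at this
      rwa [← hexp]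
    · intro h x hx
      have hdecomp : (V.projectionOnto P hcompl x + P.projectionOnto V hcompl.symm x : E) = x :=
        Submodule.projection_add_projection_eq_self hcompl x
      have := h (V.projectionOnto P hcompl x) (P.projectionOnto V hcompl.symm x) (by
        by_contra! h₀
        apply hx
        rw [← hdecomp, h₀.1, h₀.2]
        simp)
      rw [← hexp] at this
      rwa [hdecomp] at this
  have htame {z : V} (hz : 0 < Ω v z) := tame_iff hΩ hβ hPdim
    (rotationOfImage_rotationOfImage hΩ hVdim hz.ne')
    (apply_rotationOfImage_rotationOfImage hΩ hVdim hz.ne') hJP a hp'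
  have hpos (J : tameDirectSum ω V P hcompl JP) : 0 < Ω v ((J : V →L[ℝ] V) v) := by
    simpa using ((hmem J).1 J.2).2 v 0 (.inl hv)
  have hrot (J : tameDirectSum ω V P hcompl JP) :
      ((J : V →L[ℝ] V) : V →ₗ[ℝ] V) = rotationOfImage Ω v ((J : V →L[ℝ] V) v) :=
    eq_rotationOfImage hΩ hVdim ((hmem J).1 J.2).1 (hpos J).ne'
  constructor
  · let f (J : tameDirectSum ω V P hcompl JP) : {z // 0 < Ω v z} :=
      ⟨(J : V →L[ℝ] V) v, hpos J⟩
    have hf : Continuous f := by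
      refine Continuous.subtype_mk ?_ _
      fun_prop
    refine IsEmbedding.subtypeVal.comp
      (.of_comp (f := f) hf (continuous_rotationOfImage Ω v) ?_)
    convert! IsEmbedding.subtypeVal using 1
    funext J
    exact ContinuousLinearMap.coe_injective (hrot J).symm
  · have hquad {z : V} (hz : 0 < Ω v z) (k : ℝ) :
        Ω (a p) (rotationOfImage Ω v z (a p)) +
          Ω (a (JP p)) (rotationOfImage Ω v z (a (JP p))) < k ↔
        (Ω (a p) z ^ 2 + Ω (a p) v ^ 2) + (Ω (a (JP p)) z ^ 2 + Ω (a (JP p)) v ^ 2) <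
          k * Ω v z := by
      rw [apply_rotationOfImage_self, apply_rotationOfImage_self, ← mul_add,
        inv_mul_lt_iff₀ hz, mul_comm k]
    convert! convex_tameImages Ω v (a p) (a (JP p))
      (4 * β p (JP p) - 2 * Ω (a p) (a (JP p))) using 1
    ext z
    constructor
    · rintro ⟨J, rfl⟩
      refine ⟨hpos J, (hquad (hpos J) _).1 ((htame (hpos J)).1 ?_).2⟩
      rw [← hrot J]
      exact ((hmem J).1 J.2).2
    · rintro ⟨hz, hlt⟩
      refine ⟨⟨LinearMap.toContinuousLinearMap (rotationOfImage Ω v z), (hmem _).2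
        ⟨rotationOfImage_rotationOfImage hΩ hVdim hz.ne', (htame hz).2
          ⟨fun u hu => rotationOfImage_pos hΩ hVdim hz hu, (hquad hz _).2 hlt⟩⟩⟩, ?_⟩
      exact rotationOfImage_left hΩ hz.ne'
end

section
/- Let E be a 4-dimensional real vector space with a nondegenerate alternating bilinear form ω, and let θ1, θ2 ⊆ E be two symplectic planes that are complementary (θ1 ∩ θ2 = 0, θ1 + θ2 = E). Let θ2⊥ denote the ω-orthogonal complement of θ2, and let π : θ1 → θ2⊥ be the restriction to θ1 of the projection of E onto θ2⊥ along θ2; assume π does not reverse the ω-induced orientations, i.e. ω(π p, π q) ≥ 0 for all p, q ∈ θ1 with ω(p, q) > 0. Then the set of ω-tame complex structures J on E satisfying J(θ1) ⊆ θ1 and J(θ2) ⊆ θ2, topologized as a subspace of the space of linear endomorphisms of E, is nonempty and contractible. -/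
/-- The convex domain of pairs of half-plane parameters `(x₁ + i y₁, x₂ + i y₂)` whose complex
structures are jointly tame. -/
def tameDomain (k l : ℝ) : Set (ℝ × ℝ × ℝ × ℝ) :=
  {z | 0 < z.2.1 ∧ 0 < z.2.2.2 ∧
    (k * z.1 - l * z.2.2.1) ^ 2 + (k * z.2.1 + l * z.2.2.2) ^ 2 < 4 * z.2.1 * z.2.2.2}

theorem tameDomain_nonempty {k l : ℝ} (hkl : k * l < 1) : (tameDomain k l).Nonempty := by
  by_cases hk : k = 0
  · refine ⟨(0, l ^ 2 + 1, 0, 1), by simp only; positivity, by norm_num, ?_⟩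
    simp only [hk]
    nlinarith [sq_nonneg l]
  · have hk2 : 0 < k ^ 2 := by positivity
    refine ⟨(0, 2 - k * l, 0, k ^ 2), by simp only; linarith, hk2, ?_⟩
    simp only
    nlinarith [mul_pos hk2 (sub_pos.2 hkl)]

theorem convex_tameDomain (k l : ℝ) : Convex ℝ (tameDomain k l) := by
  rintro ⟨x, y, u, v⟩ ⟨hy, hv, h⟩ ⟨x', y', u', v'⟩ ⟨hy', hv', h'⟩ s t hs ht hst
  simp only [tameDomain, Set.mem_ofPred_eq, Prod.smul_mk, Prod.mk_add_mk, smul_eq_mul] at *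
  have pos : ∀ {p q : ℝ}, 0 < p → 0 < q → 0 < s * p + t * q := fun hp hq => by
    rcases hs.eq_or_lt with rfl | hs
    · obtain rfl : t = 1 := by linarith
      linarith
    · have := mul_pos hs hp
      have := mul_nonneg ht hq.le
      linarith
  refine ⟨pos hy hy', pos hv hv', ?_⟩
  set W := k * x - l * u with hW
  set V := k * y + l * v with hV
  set W' := k * x' - l * u' with hW'
  set V' := k * y' + l * v' with hV'
  have cross : W * W' + V * V' ≤ 2 * (y * v' + y' * v) := by
    refine le_of_sq_le_sq ?_ (by positivity)
    have h1 : (W ^ 2 + V ^ 2) * (W' ^ 2 + V' ^ 2) ≤ (4 * y * v) * (4 * y' * v') :=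
      mul_le_mul h.le h'.le (by positivity) (by positivity)
    nlinarith [sq_nonneg (W * V' - V * W'), sq_nonneg (y * v' - y' * v)]
  have e1 : k * (s * x + t * x') - l * (s * u + t * u') = s * W + t * W' := by rw [hW, hW']; ring
  have e2 : k * (s * y + t * y') + l * (s * v + t * v') = s * V + t * V' := by rw [hV, hV']; ring
  rw [e1, e2]
  have hd : 0 < s * s * (4 * y * v - (W ^ 2 + V ^ 2)) +
      t * t * (4 * y' * v' - (W' ^ 2 + V' ^ 2)) := by
    rcases hs.eq_or_lt with rfl | hs
    · obtain rfl : t = 1 := by linarith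
      linarith
    · have := mul_pos (mul_pos hs hs) (sub_pos.2 h)
      have := mul_nonneg (mul_nonneg ht ht) (sub_pos.2 h').le
      linarith
  nlinarith [mul_le_mul_of_nonneg_left cross (mul_nonneg hs ht)]

/-- `y₁ y₂ ω(v, J v)` in the complex coordinates `P + i β`, `U + i D` of the two planes. -/
theorem hermitian_form_pos {y₁ y₂ V W : ℝ} (hy₂ : 0 < y₂)
    (h : W ^ 2 + V ^ 2 < 4 * y₁ * y₂) {P β U D : ℝ} (hne : P ≠ 0 ∨ β ≠ 0 ∨ U ≠ 0 ∨ D ≠ 0) :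
    0 < y₂ * (P ^ 2 + β ^ 2) + y₁ * (U ^ 2 + D ^ 2) + V * (P * U + β * D) +
      W * (D * P - β * U) := by
  have key : 4 * y₂ * (y₂ * (P ^ 2 + β ^ 2) + y₁ * (U ^ 2 + D ^ 2) + V * (P * U + β * D) +
      W * (D * P - β * U)) = (2 * y₂ * P + V * U + W * D) ^ 2 +
      (2 * y₂ * β + V * D - W * U) ^ 2 + (4 * y₁ * y₂ - (W ^ 2 + V ^ 2)) * (U ^ 2 + D ^ 2) := by
    ring
  refine pos_of_mul_pos_right (a := 4 * y₂) ?_ (by positivity)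
  rw [key]
  have hs := sub_pos.2 h
  by_cases hUD : U = 0 ∧ D = 0
  · obtain ⟨rfl, rfl⟩ := hUD
    have : P ≠ 0 ∨ β ≠ 0 := by simpa using hne
    rcases this with h0 | h0
    · have : 0 < (2 * y₂ * P) ^ 2 := by positivity
      nlinarith [sq_nonneg (2 * y₂ * β)]
    · have : 0 < (2 * y₂ * β) ^ 2 := by positivity
      nlinarith [sq_nonneg (2 * y₂ * P)]
  · have : 0 < U ^ 2 + D ^ 2 := by
      by_cases hU : U = 0
      · have hD : D ≠ 0 := fun hD => hUD ⟨hU, hD⟩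
        positivity
      · positivity
    have := mul_pos hs this
    positivity

section Frame

variable {E : Type*} [NormedAddCommGroup E] [NormedSpace ℝ E]

theorem apply_eq_of_sq_eq_neg (b : Module.Basis (Fin 4) ℝ E) {J : E →L[ℝ] E}
    (hJ : ∀ x, J (J x) = -x) {i j : Fin 4} (hij : i ≠ j) {p q r s : ℝ}
    (hi : J (b i) = p • b i + q • b j)
    (hj : J (b j) = r • b i + s • b j) (hq : q ≠ 0) :
    p = -(s / q / q⁻¹) ∧ r = -(((s / q) ^ 2 + q⁻¹ ^ 2) / q⁻¹) ∧ s = s / q / q⁻¹ := by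
  have h := congrArg b.repr (hJ (b i))
  rw [hi, map_add, map_smul, map_smul, hi, hj] at h
  have h1 := DFunLike.congr_fun h i
  have h2 := DFunLike.congr_fun h j
  simp [hij, hij.symm] at h1 h2
  have hps : p = -s := mul_left_cancel₀ hq (by linarith)
  refine ⟨?_, ?_, ?_⟩
  · rw [hps]; field_simp
  · field_simp
    rw [hps] at h1
    linarith
  · field_simp

theorem eq_add_of_disjoint (b : Module.Basis (Fin 4) ℝ E) {θ₁ θ₂ : Submodule ℝ E}
    (hdisj : Disjoint θ₁ θ₂) (h0 : b 0 ∈ θ₁) (h1 : b 1 ∈ θ₁) (h2 : b 2 ∈ θ₂) (h3 : b 3 ∈ θ₂) :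
    (∀ v ∈ θ₁, v = b.repr v 0 • b 0 + b.repr v 1 • b 1) ∧
      ∀ v ∈ θ₂, v = b.repr v 2 • b 2 + b.repr v 3 • b 3 := by
  have hexp : ∀ v, v = (b.repr v 0 • b 0 + b.repr v 1 • b 1) +
      (b.repr v 2 • b 2 + b.repr v 3 • b 3) := fun v => by
    rw [← add_assoc, ← Fin.sum_univ_four (fun i => b.repr v i • b i), b.sum_repr]
  have hp : ∀ v, b.repr v 0 • b 0 + b.repr v 1 • b 1 ∈ θ₁ := fun v =>
    add_mem (Submodule.smul_mem _ _ h0) (Submodule.smul_mem _ _ h1)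
  have hu : ∀ v, b.repr v 2 • b 2 + b.repr v 3 • b 3 ∈ θ₂ := fun v =>
    add_mem (Submodule.smul_mem _ _ h2) (Submodule.smul_mem _ _ h3)
  refine ⟨fun v hv => ?_, fun v hv => ?_⟩
  · rw [← sub_eq_zero]
    refine Submodule.disjoint_def.1 hdisj _ (sub_mem hv (hp v)) ?_
    rw [sub_eq_of_eq_add' (hexp v)]
    exact hu v
  · rw [← sub_eq_zero]
    refine Submodule.disjoint_def.1 hdisj _ ?_ (sub_mem hv (hu v))
    rw [sub_eq_of_eq_add (hexp v)]
    exact hp v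

/-- The Gram data of an alternating form in a basis adapted to two symplectic planes. -/
structure IsAdaptedFrame (b : Module.Basis (Fin 4) ℝ E) (ω : E →ₗ[ℝ] E →ₗ[ℝ] ℝ) (k l : ℝ) :
    Prop where
  alt : ω.IsAlt
  h01 : ω (b 0) (b 1) = 1
  h23 : ω (b 2) (b 3) = 1
  h02 : ω (b 0) (b 2) = 0
  h13 : ω (b 1) (b 3) = 0
  h03 : ω (b 0) (b 3) = k
  h21 : ω (b 2) (b 1) = l

theorem exists_isAdaptedFrame {ω : E →ₗ[ℝ] E →ₗ[ℝ] ℝ} (hdim : Module.finrank ℝ E = 4)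
    (halt : ω.IsAlt) (hnd : ∀ x, (∀ y, ω x y = 0) → x = 0) {θ₁ θ₂ : Submodule ℝ E}
    (hθ₁ : θ₁ ≠ ⊥) (hθ₂ : θ₂ ≠ ⊥)
    (h₁ : ∀ x ∈ θ₁, x ≠ 0 → ∃ y ∈ θ₁, ω x y ≠ 0)
    (h₂ : ∀ x ∈ θ₂, x ≠ 0 → ∃ y ∈ θ₂, ω x y ≠ 0)
    (hdisj : Disjoint θ₁ θ₂) (pr : E →ₗ[ℝ] E)
    (hperp : ∀ x, ∀ u ∈ θ₂, ω (pr x) u = 0) (hproj : ∀ x, x - pr x ∈ θ₂)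
    (hor : ∀ p ∈ θ₁, ∀ q ∈ θ₁, 0 < ω p q → 0 ≤ ω (pr p) (pr q)) :
    ∃ (b : Module.Basis (Fin 4) ℝ E) (k l : ℝ), IsAdaptedFrame b ω k l ∧ k * l < 1 ∧
      b 0 ∈ θ₁ ∧ b 1 ∈ θ₁ ∧ b 2 ∈ θ₂ ∧ b 3 ∈ θ₂ := by
  have hneg : ∀ x y, ω x y = -ω y x := fun x y => (halt.neg _ _).symm
  have partner : ∀ {θ : Submodule ℝ E}, (∀ x ∈ θ, x ≠ 0 → ∃ y ∈ θ, ω x y ≠ 0) →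
      ∀ x ∈ θ, x ≠ 0 → ∃ y ∈ θ, ω x y = 1 := fun hθ x hx hx0 => by
    obtain ⟨y, hy, hxy⟩ := hθ x hx hx0
    exact ⟨(ω x y)⁻¹ • y, Submodule.smul_mem _ _ hy, by simp [hxy]⟩
  obtain ⟨e₁, he₁, e₂, he₂, f₁, hf₁, f₂, hf₂, he, hf, he₁f₁, he₂f₂⟩ :
      ∃ e₁ ∈ θ₁, ∃ e₂ ∈ θ₁, ∃ f₁ ∈ θ₂, ∃ f₂ ∈ θ₂,
        ω e₁ e₂ = 1 ∧ ω f₁ f₂ = 1 ∧ ω e₁ f₁ = 0 ∧ ω e₂ f₂ = 0 := by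
    by_cases hA : ∀ p ∈ θ₁, ∀ u ∈ θ₂, ω p u = 0
    · obtain ⟨e₁, he₁, he₁0⟩ := Submodule.exists_mem_ne_zero_of_ne_bot hθ₁
      obtain ⟨f₁, hf₁, hf₁0⟩ := Submodule.exists_mem_ne_zero_of_ne_bot hθ₂
      obtain ⟨e₂, he₂, he⟩ := partner h₁ e₁ he₁ he₁0
      obtain ⟨f₂, hf₂, hf⟩ := partner h₂ f₁ hf₁ hf₁0
      exact ⟨e₁, he₁, e₂, he₂, f₁, hf₁, f₂, hf₂, he, hf, hA _ he₁ _ hf₁, hA _ he₂ _ hf₂⟩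
    · push Not at hA
      obtain ⟨e₁, he₁, u, hu, heu⟩ := hA
      have he₁0 : e₁ ≠ 0 := by rintro rfl; simp at heu
      have hu0 : u ≠ 0 := by rintro rfl; simp at heu
      obtain ⟨h, hh, heh⟩ := partner h₁ e₁ he₁ he₁0
      obtain ⟨g, hg, hug⟩ := partner h₂ u hu hu0
      refine ⟨e₁, he₁, h - (ω h u / ω e₁ u) • e₁, sub_mem hh (Submodule.smul_mem _ _ he₁),
        -g + (ω e₁ g / ω e₁ u) • u, add_mem (neg_mem hg) (Submodule.smul_mem _ _ hu), u, hu,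
        ?_, ?_, ?_, ?_⟩
      · simp [heh, halt.self_eq_zero]
      · simp [hneg g u, hug, halt.self_eq_zero]
      · simp [heu]
      · simp [heu]
  have hli : LinearIndependent ℝ ![e₁, e₂, f₁, f₂] := by
    rw [Fintype.linearIndependent_iff]
    intro g hg
    simp only [Fin.sum_univ_four, Matrix.cons_val] at hg
    have hp : g 0 • e₁ + g 1 • e₂ ∈ θ₁ :=
      add_mem (Submodule.smul_mem _ _ he₁) (Submodule.smul_mem _ _ he₂)
    have hu : g 2 • f₁ + g 3 • f₂ ∈ θ₂ :=
      add_mem (Submodule.smul_mem _ _ hf₁) (Submodule.smul_mem _ _ hf₂)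
    have hpu : g 0 • e₁ + g 1 • e₂ = -(g 2 • f₁ + g 3 • f₂) :=
      eq_neg_of_add_eq_zero_left (by rw [← hg]; abel)
    have hp0 := Submodule.disjoint_def.1 hdisj _ hp (hpu ▸ neg_mem hu)
    have hu0 : g 2 • f₁ + g 3 • f₂ = 0 := by rwa [hpu, neg_eq_zero] at hp0
    have c1 := congrArg (ω e₁) hp0
    have c0 := congrArg (fun v => ω v e₂) hp0
    have c3 := congrArg (ω f₁) hu0
    have c2 := congrArg (fun v => ω v f₂) hu0
    simp [he, hf, halt.self_eq_zero] at c0 c1 c2 c3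
    intro i
    fin_cases i <;> assumption
  let b := basisOfLinearIndependentOfCardEqFinrank hli (by simp [hdim])
  have hb : ⇑b = ![e₁, e₂, f₁, f₂] := coe_basisOfLinearIndependentOfCardEqFinrank _ _
  have hb0 : b 0 = e₁ := by simp [hb]
  have hb1 : b 1 = e₂ := by simp [hb]
  have hb2 : b 2 = f₁ := by simp [hb]
  have hb3 : b 3 = f₂ := by simp [hb]
  have hexp : ∀ v, v = b.repr v 0 • e₁ + b.repr v 1 • e₂ + b.repr v 2 • f₁ + b.repr v 3 • f₂ :=
    fun v => by
      rw [← hb0, ← hb1, ← hb2, ← hb3, ← Fin.sum_univ_four (fun i => b.repr v i • b i), b.sum_repr]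
  have hpre₁ : pr e₁ = e₁ - ω e₁ f₂ • f₁ := by
    have hw : pr e₁ - (e₁ - ω e₁ f₂ • f₁) ∈ θ₂ := by
      have : pr e₁ - (e₁ - ω e₁ f₂ • f₁) = -(e₁ - pr e₁) + ω e₁ f₂ • f₁ := by abel
      rw [this]
      exact add_mem (neg_mem (hproj _)) (Submodule.smul_mem _ _ hf₁)
    obtain ⟨c, d, hw'⟩ : ∃ c d : ℝ, pr e₁ - (e₁ - ω e₁ f₂ • f₁) = c • f₁ + d • f₂ :=
      ⟨_, _, hb2 ▸ hb3 ▸ (eq_add_of_disjoint b hdisj (hb0 ▸ he₁) (hb1 ▸ he₂) (hb2 ▸ hf₁)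
        (hb3 ▸ hf₂)).2 _ hw⟩
    have hc := congrArg (fun v => ω v f₂) hw'
    have hd := congrArg (fun v => ω v f₁) hw'
    simp only [map_sub, map_add, map_smul, LinearMap.sub_apply, LinearMap.add_apply,
      LinearMap.smul_apply, hperp e₁ _ hf₁, hperp e₁ _ hf₂, hf, hneg f₂ f₁, he₁f₁,
      halt.self_eq_zero, smul_eq_mul, mul_one, mul_zero, sub_self, zero_add, add_zero] at hc hd
    rw [← hc, show d = 0 by linarith] at hw'
    simpa [sub_eq_zero] using hw'
  have hpre₂ : ω (pr e₁) (pr e₂) = ω (pr e₁) e₂ := by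
    have := hperp e₁ _ (hproj e₂)
    rw [map_sub, sub_eq_zero] at this
    exact this.symm
  have hval : ω (pr e₁) e₂ = 1 - ω e₁ f₂ * ω f₁ e₂ := by simp [hpre₁, he]
  refine ⟨b, ω e₁ f₂, ω f₁ e₂, ⟨halt, ?_, ?_, ?_, ?_, ?_, ?_⟩, ?_, ?_, ?_, ?_, ?_⟩
  · rwa [hb0, hb1]
  · rwa [hb2, hb3]
  · rwa [hb0, hb2]
  · rwa [hb1, hb3]
  · rw [hb0, hb3]
  · rw [hb2, hb1]
  · have hge := hor e₁ he₁ e₂ he₂ (by rw [he]; exact one_pos)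
    rw [hpre₂, hval] at hge
    refine lt_of_le_of_ne (by linarith) fun heq => ?_
    have hzero : pr e₁ = 0 := hnd _ fun y => by
      rw [hexp y]
      have h0 : ω (pr e₁) e₁ = 0 := by simp [hpre₁, halt.self_eq_zero, hneg f₁ e₁, he₁f₁]
      simp [h0, hval, heq, hperp e₁ _ hf₁, hperp e₁ _ hf₂]
    have := hproj e₁
    rw [hzero, sub_zero] at this
    have := Submodule.disjoint_def.1 hdisj _ he₁ this
    simp [this] at he
  · rwa [hb0]
  · rwa [hb1]
  · rwa [hb2]
  · rwa [hb3]

variable [FiniteDimensional ℝ E]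

/-- The endomorphism preserving the planes spanned by `b 0, b 1` and by `b 2, b 3` with half-plane
parameters `x₁ + i y₁` and `x₂ + i y₂`. -/
noncomputable def halfPlaneEndo (b : Module.Basis (Fin 4) ℝ E) (z : ℝ × ℝ × ℝ × ℝ) : E →L[ℝ] E :=
  (b.coord 0).toContinuousLinearMap.smulRight (-(z.1 / z.2.1) • b 0 + z.2.1⁻¹ • b 1) +
  (b.coord 1).toContinuousLinearMap.smulRight
    (-((z.1 ^ 2 + z.2.1 ^ 2) / z.2.1) • b 0 + (z.1 / z.2.1) • b 1) +
  (b.coord 2).toContinuousLinearMap.smulRight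
    (-(z.2.2.1 / z.2.2.2) • b 2 + z.2.2.2⁻¹ • b 3) +
  (b.coord 3).toContinuousLinearMap.smulRight
    (-((z.2.2.1 ^ 2 + z.2.2.2 ^ 2) / z.2.2.2) • b 2 + (z.2.2.1 / z.2.2.2) • b 3)

variable (b : Module.Basis (Fin 4) ℝ E)

theorem halfPlaneEndo_apply (z : ℝ × ℝ × ℝ × ℝ) (v : E) :
    halfPlaneEndo b z v =
      b.repr v 0 • (-(z.1 / z.2.1) • b 0 + z.2.1⁻¹ • b 1) +
      b.repr v 1 • (-((z.1 ^ 2 + z.2.1 ^ 2) / z.2.1) • b 0 + (z.1 / z.2.1) • b 1) +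
      b.repr v 2 • (-(z.2.2.1 / z.2.2.2) • b 2 + z.2.2.2⁻¹ • b 3) +
      b.repr v 3 • (-((z.2.2.1 ^ 2 + z.2.2.2 ^ 2) / z.2.2.2) • b 2 +
        (z.2.2.1 / z.2.2.2) • b 3) := by
  simp [halfPlaneEndo]

theorem continuousOn_halfPlaneEndo :
    ContinuousOn (halfPlaneEndo b) {z | z.2.1 ≠ 0 ∧ z.2.2.2 ≠ 0} := by
  have hL : ∀ (i : Fin 4) (g : ℝ × ℝ × ℝ × ℝ → E), ContinuousOn g {z | z.2.1 ≠ 0 ∧ z.2.2.2 ≠ 0} →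
      ContinuousOn (fun z => (b.coord i).toContinuousLinearMap.smulRight (g z))
        {z | z.2.1 ≠ 0 ∧ z.2.2.2 ≠ 0} := fun i g hg =>
    (ContinuousLinearMap.smulRightL ℝ E E
      (b.coord i).toContinuousLinearMap).continuous.comp_continuousOn hg
  unfold halfPlaneEndo
  have h₁ : ContinuousOn (fun z : ℝ × ℝ × ℝ × ℝ => z.2.1⁻¹) {z | z.2.1 ≠ 0 ∧ z.2.2.2 ≠ 0} :=
    ContinuousOn.inv₀ (by fun_prop) fun z hz => hz.1
  have h₂ : ContinuousOn (fun z : ℝ × ℝ × ℝ × ℝ => z.2.2.2⁻¹) {z | z.2.1 ≠ 0 ∧ z.2.2.2 ≠ 0} :=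
    ContinuousOn.inv₀ (by fun_prop) fun z hz => hz.2
  simp only [div_eq_mul_inv]
  refine ((ContinuousOn.add (hL _ _ ?_) (hL _ _ ?_)).add (hL _ _ ?_)).add (hL _ _ ?_) <;> fun_prop

theorem halfPlaneEndo_sq {z : ℝ × ℝ × ℝ × ℝ} (h₁ : z.2.1 ≠ 0) (h₂ : z.2.2.2 ≠ 0) (v : E) :
    halfPlaneEndo b z (halfPlaneEndo b z v) = -v := by
  obtain ⟨x, y, u, w⟩ := z
  simp only at h₁ h₂
  apply b.repr.injective
  ext i
  fin_cases i <;> simp [halfPlaneEndo_apply] <;> field_simp <;> ring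

/-- The half-plane parameters of an endomorphism, read off in the basis `b`. -/
noncomputable def halfPlaneCoords (J : E →L[ℝ] E) : ℝ × ℝ × ℝ × ℝ :=
  (b.repr (J (b 1)) 1 / b.repr (J (b 0)) 1, (b.repr (J (b 0)) 1)⁻¹,
    b.repr (J (b 3)) 3 / b.repr (J (b 2)) 3, (b.repr (J (b 2)) 3)⁻¹)

theorem continuousOn_halfPlaneCoords :
    ContinuousOn (halfPlaneCoords b) {J | b.repr (J (b 0)) 1 ≠ 0 ∧ b.repr (J (b 2)) 3 ≠ 0} := by
  have hc : ∀ i j : Fin 4, Continuous fun J : E →L[ℝ] E => b.repr (J (b i)) j := fun i j =>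
    (b.coord j).continuous_of_finiteDimensional.comp (by fun_prop)
  unfold halfPlaneCoords
  exact ((hc 1 1).continuousOn.div (hc 0 1).continuousOn fun _ h => h.1).prodMk
    (((hc 0 1).continuousOn.inv₀ fun _ h => h.1).prodMk
      (((hc 3 3).continuousOn.div (hc 2 3).continuousOn fun _ h => h.2).prodMk
        ((hc 2 3).continuousOn.inv₀ fun _ h => h.2)))

theorem halfPlaneCoords_halfPlaneEndo {z : ℝ × ℝ × ℝ × ℝ} (h₁ : z.2.1 ≠ 0) (h₂ : z.2.2.2 ≠ 0) :
    halfPlaneCoords b (halfPlaneEndo b z) = z := by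
  obtain ⟨x, y, u, w⟩ := z
  simp only at h₁ h₂
  simp [halfPlaneCoords, halfPlaneEndo_apply, h₁, h₂]

theorem halfPlaneEndo_halfPlaneCoords {J : E →L[ℝ] E} (hJ : ∀ x, J (J x) = -x)
    {p q r s p' q' r' s' : ℝ}
    (h0 : J (b 0) = p • b 0 + q • b 1) (h1 : J (b 1) = r • b 0 + s • b 1)
    (h2 : J (b 2) = p' • b 2 + q' • b 3) (h3 : J (b 3) = r' • b 2 + s' • b 3)
    (hq : q ≠ 0) (hq' : q' ≠ 0) :
    halfPlaneEndo b (halfPlaneCoords b J) = J := by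
  obtain ⟨e1, e2, e3⟩ := apply_eq_of_sq_eq_neg b hJ (by decide) h0 h1 hq
  obtain ⟨e1', e2', e3'⟩ := apply_eq_of_sq_eq_neg b hJ (by decide) h2 h3 hq'
  have hc : halfPlaneCoords b J = (s / q, q⁻¹, s' / q', q'⁻¹) := by
    simp [halfPlaneCoords, h0, h1, h2, h3]
  apply ContinuousLinearMap.coe_injective
  refine b.ext fun i => ?_
  rw [hc]
  fin_cases i
  · simp [halfPlaneEndo_apply, h0, -div_inv_eq_mul, ← e1]
  · simp [halfPlaneEndo_apply, h1, -div_inv_eq_mul, -inv_pow, -neg_smul, ← e2, ← e3]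
  · simp [halfPlaneEndo_apply, h2, -div_inv_eq_mul, ← e1']
  · simp [halfPlaneEndo_apply, h3, -div_inv_eq_mul, -inv_pow, -neg_smul, ← e2', ← e3']

variable {b} {ω : E →ₗ[ℝ] E →ₗ[ℝ] ℝ} {k l : ℝ}

theorem IsAdaptedFrame.apply_halfPlaneEndo (hb : IsAdaptedFrame b ω k l) {x₁ y₁ x₂ y₂ : ℝ}
    (h₁ : y₁ ≠ 0) (h₂ : y₂ ≠ 0) (a c d e : ℝ) :
    y₁ * y₂ * ω (a • b 0 + c • b 1 + d • b 2 + e • b 3)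
      (halfPlaneEndo b (x₁, y₁, x₂, y₂) (a • b 0 + c • b 1 + d • b 2 + e • b 3)) =
      y₂ * ((a + x₁ * c) ^ 2 + (y₁ * c) ^ 2) + y₁ * ((d + x₂ * e) ^ 2 + (y₂ * e) ^ 2) +
        (k * y₁ + l * y₂) * ((a + x₁ * c) * (d + x₂ * e) + (y₁ * c) * (y₂ * e)) +
        (k * x₁ - l * x₂) * ((y₂ * e) * (a + x₁ * c) - (y₁ * c) * (d + x₂ * e)) := by
  have hs : ∀ i j, ω (b i) (b j) = - ω (b j) (b i) := fun i j => (hb.alt.neg _ _).symm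
  have h10 := hs 1 0
  have h32 := hs 3 2
  have h20 := hs 2 0
  have h31 := hs 3 1
  have h30 := hs 3 0
  have h12 := hs 1 2
  rw [hb.h01] at h10
  rw [hb.h23] at h32
  rw [hb.h02] at h20
  rw [hb.h13] at h31
  rw [hb.h03] at h30
  rw [hb.h21] at h12
  simp [halfPlaneEndo_apply, hb.alt.self_eq_zero, hb.h01, hb.h23, hb.h02, hb.h13, hb.h03, hb.h21,
    h10, h32, h20, h31, h30, h12]
  field_simp
  ring

theorem IsAdaptedFrame.tame_halfPlaneEndo_iff (hb : IsAdaptedFrame b ω k l)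
    {z : ℝ × ℝ × ℝ × ℝ} (h₁ : 0 < z.2.1) (h₂ : 0 < z.2.2.2) :
    (∀ v, v ≠ 0 → 0 < ω v (halfPlaneEndo b z v)) ↔ z ∈ tameDomain k l := by
  obtain ⟨x₁, y₁, x₂, y₂⟩ := z
  simp only at h₁ h₂
  constructor
  · intro h
    refine ⟨h₁, h₂, ?_⟩
    simp only
    set V := k * y₁ + l * y₂ with hV
    set W := k * x₁ - l * x₂ with hW
    have hv := h ((-V / (2 * y₂) - x₁ * (W / (2 * y₂ * y₁))) • b 0 + (W / (2 * y₂ * y₁)) • b 1 +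
      (1 : ℝ) • b 2 + (0 : ℝ) • b 3) fun h0 => by
        have := DFunLike.congr_fun (congrArg b.repr h0) 2
        simp at this
    have hv' := mul_pos (mul_pos h₁ h₂) hv
    rw [hb.apply_halfPlaneEndo h₁.ne' h₂.ne', ← hV, ← hW] at hv'
    have e : y₁ * (W / (2 * y₂ * y₁)) = W / (2 * y₂) := by field_simp
    rw [e, sub_add_cancel] at hv'
    have := mul_pos (mul_pos four_pos h₂) hv'
    field_simp at this
    nlinarith
  · rintro ⟨-, -, h⟩ v hv
    simp only at h
    have hsum : v = b.repr v 0 • b 0 + b.repr v 1 • b 1 + b.repr v 2 • b 2 + b.repr v 3 • b 3 := by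
      rw [← Fin.sum_univ_four (fun i => b.repr v i • b i), b.sum_repr]
    refine pos_of_mul_pos_right (a := y₁ * y₂) ?_ (by positivity)
    rw [hsum, hb.apply_halfPlaneEndo h₁.ne' h₂.ne']
    refine hermitian_form_pos h₂ h ?_
    by_contra! hc
    obtain ⟨c0, c1, c2, c3⟩ := hc
    have c1 : b.repr v 1 = 0 := by simpa [h₁.ne'] using c1
    have c3 : b.repr v 3 = 0 := by simpa [h₂.ne'] using c3
    have c0 : b.repr v 0 = 0 := by simpa [c1] using c0
    have c2 : b.repr v 2 = 0 := by simpa [c3] using c2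
    exact hv (by rw [hsum, c0, c1, c2, c3]; simp)

/-- The tame complex structures preserving two symplectic planes, in half-plane parameters. -/
theorem nonempty_homeomorph_tameDomain (hb : IsAdaptedFrame b ω k l) {θ₁ θ₂ : Submodule ℝ E}
    (hdisj : Disjoint θ₁ θ₂) (h0 : b 0 ∈ θ₁) (h1 : b 1 ∈ θ₁) (h2 : b 2 ∈ θ₂) (h3 : b 3 ∈ θ₂) :
    Nonempty (tameDomain k l ≃ₜ {J : E →L[ℝ] E // (∀ x, J (J x) = -x) ∧
        (∀ x, x ≠ 0 → 0 < ω x (J x)) ∧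
        (∀ x ∈ θ₁, J x ∈ θ₁) ∧ ∀ x ∈ θ₂, J x ∈ θ₂}) := by
  obtain ⟨hθ₁, hθ₂⟩ := eq_add_of_disjoint b hdisj h0 h1 h2 h3
  have hmem : ∀ z ∈ tameDomain k l, (∀ x, halfPlaneEndo b z (halfPlaneEndo b z x) = -x) ∧
      (∀ x, x ≠ 0 → 0 < ω x (halfPlaneEndo b z x)) ∧
      (∀ x ∈ θ₁, halfPlaneEndo b z x ∈ θ₁) ∧ ∀ x ∈ θ₂, halfPlaneEndo b z x ∈ θ₂ := fun z hz => by
    refine ⟨halfPlaneEndo_sq b hz.1.ne' hz.2.1.ne',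
      (hb.tame_halfPlaneEndo_iff hz.1 hz.2.1).2 hz, fun x hx => ?_, fun x hx => ?_⟩
    · have r2 : b.repr x 2 = 0 := by rw [hθ₁ x hx]; simp
      have r3 : b.repr x 3 = 0 := by rw [hθ₁ x hx]; simp
      have hc : ∀ r s : ℝ, r • b 0 + s • b 1 ∈ θ₁ := fun r s =>
        add_mem (Submodule.smul_mem _ _ h0) (Submodule.smul_mem _ _ h1)
      simp only [halfPlaneEndo_apply, r2, r3, zero_smul, add_zero]
      exact add_mem (Submodule.smul_mem _ _ (hc _ _)) (Submodule.smul_mem _ _ (hc _ _))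
    · have r0 : b.repr x 0 = 0 := by rw [hθ₂ x hx]; simp
      have r1 : b.repr x 1 = 0 := by rw [hθ₂ x hx]; simp
      have hc : ∀ r s : ℝ, r • b 2 + s • b 3 ∈ θ₂ := fun r s =>
        add_mem (Submodule.smul_mem _ _ h2) (Submodule.smul_mem _ _ h3)
      simp only [halfPlaneEndo_apply, r0, r1, zero_smul, add_zero, zero_add]
      exact add_mem (Submodule.smul_mem _ _ (hc _ _)) (Submodule.smul_mem _ _ (hc _ _))
  have hpos : ∀ J : E →L[ℝ] E, (∀ x, x ≠ 0 → 0 < ω x (J x)) →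
      (∀ x ∈ θ₁, J x ∈ θ₁) → (∀ x ∈ θ₂, J x ∈ θ₂) →
      0 < b.repr (J (b 0)) 1 ∧ 0 < b.repr (J (b 2)) 3 := fun J hJ hJ₁ hJ₂ => by
    constructor
    · have := hJ (b 0) (b.ne_zero 0)
      rw [hθ₁ _ (hJ₁ _ h0)] at this
      simpa [hb.alt.self_eq_zero, hb.h01] using this
    · have := hJ (b 2) (b.ne_zero 2)
      rw [hθ₂ _ (hJ₂ _ h2)] at this
      simpa [hb.alt.self_eq_zero, hb.h23] using this
  have hinv : ∀ J : E →L[ℝ] E, (∀ x, J (J x) = -x) → (∀ x, x ≠ 0 → 0 < ω x (J x)) →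
      (∀ x ∈ θ₁, J x ∈ θ₁) → (∀ x ∈ θ₂, J x ∈ θ₂) →
      halfPlaneEndo b (halfPlaneCoords b J) = J := fun J hJ hJt hJ₁ hJ₂ =>
    halfPlaneEndo_halfPlaneCoords b hJ (hθ₁ _ (hJ₁ _ h0)) (hθ₁ _ (hJ₁ _ h1))
      (hθ₂ _ (hJ₂ _ h2)) (hθ₂ _ (hJ₂ _ h3)) (hpos J hJt hJ₁ hJ₂).1.ne' (hpos J hJt hJ₁ hJ₂).2.ne'
  have hcoords : ∀ J : {J : E →L[ℝ] E // (∀ x, J (J x) = -x) ∧ (∀ x, x ≠ 0 → 0 < ω x (J x)) ∧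
      (∀ x ∈ θ₁, J x ∈ θ₁) ∧ ∀ x ∈ θ₂, J x ∈ θ₂}, halfPlaneCoords b J ∈ tameDomain k l := by
    rintro ⟨J, hJ, hJt, hJ₁, hJ₂⟩
    have h := hpos J hJt hJ₁ hJ₂
    refine (hb.tame_halfPlaneEndo_iff (inv_pos.2 h.1) (inv_pos.2 h.2)).1 ?_
    rwa [hinv J hJ hJt hJ₁ hJ₂]
  exact ⟨{
    toFun := fun z => ⟨halfPlaneEndo b z, hmem z z.2⟩
    invFun := fun J => ⟨halfPlaneCoords b J, hcoords J⟩
    left_inv := fun z => Subtype.ext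
      (halfPlaneCoords_halfPlaneEndo b z.2.1.ne' z.2.2.1.ne')
    right_inv := fun J => Subtype.ext (hinv J J.2.1 J.2.2.1 J.2.2.2.1 J.2.2.2.2)
    continuous_toFun := ((continuousOn_halfPlaneEndo b).comp_continuous
      continuous_subtype_val fun z => ⟨z.2.1.ne', z.2.2.1.ne'⟩).subtype_mk _
    continuous_invFun := ((continuousOn_halfPlaneCoords b).comp_continuous
      continuous_subtype_val fun J =>
        have h := hpos J J.2.2.1 J.2.2.2.1 J.2.2.2.2
        ⟨h.1.ne', h.2.ne'⟩).subtype_mk hcoords }⟩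

end Frame

/-- Let `(E, ω)` be a 4-dimensional real symplectic vector space, `θ1, θ2 ⊆ E`
complementary symplectic planes, and `pr` the projection of `E` onto the
`ω`-orthogonal complement of `θ2` along `θ2`; assume the restriction of `pr` to
`θ1` does not reverse orientations. Then the space of `ω`-tame complex
structures on `E` preserving both `θ1` and `θ2` (as a subspace of the linear
endomorphisms of `E`) is nonempty and contractible. -/
theorem stmt_2 {E : Type*} [NormedAddCommGroup E] [NormedSpace ℝ E]
    [FiniteDimensional ℝ E] (hdim : Module.finrank ℝ E = 4)
    (ω : E →ₗ[ℝ] E →ₗ[ℝ] ℝ)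
    (halt : ∀ x, ω x x = 0)
    (hnd : ∀ x, (∀ y, ω x y = 0) → x = 0)
    (θ1 θ2 : Submodule ℝ E)
    (h1dim : Module.finrank ℝ θ1 = 2) (h2dim : Module.finrank ℝ θ2 = 2)
    (h1symp : ∀ x ∈ θ1, x ≠ 0 → ∃ y ∈ θ1, ω x y ≠ 0)
    (h2symp : ∀ x ∈ θ2, x ≠ 0 → ∃ y ∈ θ2, ω x y ≠ 0)
    (hinter : θ1 ⊓ θ2 = ⊥) (hsum : θ1 ⊔ θ2 = ⊤)
    (pr : E →ₗ[ℝ] E)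
    (hprperp : ∀ x : E, ∀ u ∈ θ2, ω (pr x) u = 0)
    (hprproj : ∀ x : E, x - pr x ∈ θ2)
    (hor : ∀ p ∈ θ1, ∀ q ∈ θ1, 0 < ω p q → 0 ≤ ω (pr p) (pr q)) :
    Nonempty {J : E →L[ℝ] E // (∀ x, J (J x) = -x) ∧
        (∀ x, x ≠ 0 → 0 < ω x (J x)) ∧
        (∀ x ∈ θ1, J x ∈ θ1) ∧ ∀ x ∈ θ2, J x ∈ θ2} ∧
    ContractibleSpace {J : E →L[ℝ] E // (∀ x, J (J x) = -x) ∧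
        (∀ x, x ≠ 0 → 0 < ω x (J x)) ∧
        (∀ x ∈ θ1, J x ∈ θ1) ∧ ∀ x ∈ θ2, J x ∈ θ2} := by
  have hdisj : Disjoint θ1 θ2 := disjoint_iff.2 hinter
  have hne : ∀ θ : Submodule ℝ E, Module.finrank ℝ θ = 2 → θ ≠ ⊥ := by
    rintro _ h rfl
    simp at h
  obtain ⟨b, k, l, hb, hkl, h0, h1, h2, h3⟩ := exists_isAdaptedFrame hdim halt hnd
    (hne θ1 h1dim) (hne θ2 h2dim) h1symp h2symp hdisj pr hprperp hprproj hor
  obtain ⟨Φ⟩ := nonempty_homeomorph_tameDomain hb hdisj h0 h1 h2 h3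
  have := (convex_tameDomain k l).contractibleSpace (tameDomain_nonempty hkl)
  have := Φ.symm.contractibleSpace
  exact ⟨inferInstance, this⟩
end

section
/- Let V be a 2-dimensional real vector space with a nondegenerate alternating bilinear form ω, and let v ∈ V be nonzero. Then the map J ↦ J(v) is a bijection from the set of ω-tame complex structures on V onto the open half-plane {u ∈ V : ω(v, u) > 0}. -/
theorem exists_eq_smul_add_smul_of_alternating_ne_zero {V : Type*} [AddCommGroup V] [Module ℝ V]
    (hdim : Module.finrank ℝ V = 2) (ω : V →ₗ[ℝ] V →ₗ[ℝ] ℝ) (halt : ∀ x, ω x x = 0)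
    {v u : V} (h : ω v u ≠ 0) (x : V) : ∃ a b : ℝ, a • v + b • u = x := by
  have hli : LinearIndependent ℝ ![v, u] := by
    rw [LinearIndependent.pair_iff]
    intro s t hst
    have h1 := congrArg (ω v) hst
    have h2 := congrArg (fun y => ω y u) hst
    simp [halt, h] at h1 h2
    exact ⟨h2, h1⟩
  have hspan := hli.span_eq_top_of_card_eq_finrank (by simp [hdim])
  have hx : x ∈ Submodule.span ℝ (Set.range ![v, u]) := hspan ▸ Submodule.mem_top
  rwa [Matrix.range_cons, Matrix.range_cons, Matrix.range_empty, Set.union_empty,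
    Set.singleton_union, Submodule.mem_span_pair] at hx

/-- On a 2-dimensional real symplectic vector space `(V, ω)` with a fixed nonzero
vector `v`, the map `J ↦ J v` is a bijection from the set of `ω`-tame complex
structures on `V` onto the open half-plane `{u | ω(v, u) > 0}`. -/
theorem stmt_3 {V : Type*} [AddCommGroup V] [Module ℝ V]
    (hdim : Module.finrank ℝ V = 2)
    (ω : V →ₗ[ℝ] V →ₗ[ℝ] ℝ)
    (halt : ∀ x, ω x x = 0)
    (hnd : ∀ x, (∀ y, ω x y = 0) → x = 0)
    (v : V) (hv : v ≠ 0) :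
    Set.BijOn (fun J : V →ₗ[ℝ] V => J v)
      {J : V →ₗ[ℝ] V | (∀ x, J (J x) = -x) ∧ ∀ x, x ≠ 0 → 0 < ω x (J x)}
      {u : V | 0 < ω v u} := by
  refine ⟨fun J hJ => hJ.2 v hv, ?_, ?_⟩
  · rintro J ⟨hJ, hJt⟩ K ⟨hK, -⟩ hJK
    replace hJK : J v = K v := hJK
    ext x
    obtain ⟨a, b, rfl⟩ :=
      exists_eq_smul_add_smul_of_alternating_ne_zero hdim ω halt (hJt v hv).ne' x
    rw [map_add, map_add, map_smul, map_smul, map_smul, map_smul, hJ, hJK, hK]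
  · intro u hu
    have hc : 0 < ω v u := hu
    have hskew : ω u v = -ω v u := (LinearMap.IsAlt.neg (B := ω) halt v u).symm
    let J : V →ₗ[ℝ] V :=
      (ω v u)⁻¹ • ((ω.flip u).smulRight u - (ω v).smulRight v)
    have hJv : J v = u := by simp [J, halt, smul_smul, hc.ne']
    have hJu : J u = -v := by simp [J, halt, smul_smul, hc.ne']
    refine ⟨J, ⟨fun x => ?_, fun x hx => ?_⟩, hJv⟩
    · obtain ⟨a, b, rfl⟩ :=
        exists_eq_smul_add_smul_of_alternating_ne_zero hdim ω halt hc.ne' x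
      simp only [map_add, map_smul, map_neg, hJv, hJu]
      module
    · obtain ⟨a, b, rfl⟩ :=
        exists_eq_smul_add_smul_of_alternating_ne_zero hdim ω halt hc.ne' x
      have hval : ω (a • v + b • u) (J (a • v + b • u)) = (a ^ 2 + b ^ 2) * ω v u := by
        simp only [map_add, map_smul, map_neg, hJv, hJu, LinearMap.add_apply,
          LinearMap.smul_apply, smul_eq_mul, halt, hskew]
        ring
      rw [hval]
      refine mul_pos ?_ hc
      by_contra! hab
      have ha : a = 0 := by nlinarith [sq_nonneg a, sq_nonneg b]
      have hb : b = 0 := by nlinarith [sq_nonneg a, sq_nonneg b]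
      simp [ha, hb] at hx
end

section
/- Let V be a 2-dimensional real vector space with a nondegenerate alternating bilinear form ω, and let J be a complex structure on V. If there exists a nonzero vector v ∈ V with ω(v, J v) > 0, then ω(x, J x) > 0 for every nonzero x ∈ V, i.e. J is ω-tame. -/
/-- On a 2-dimensional real symplectic vector space `(V, ω)`, a complex structure `J`
is `ω`-tame as soon as `ω(v, J v) > 0` for a single nonzero vector `v`. -/
theorem stmt_5 {V : Type*} [AddCommGroup V] [Module ℝ V]
    (hdim : Module.finrank ℝ V = 2)
    (ω : V →ₗ[ℝ] V →ₗ[ℝ] ℝ)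
    (halt : ∀ x, ω x x = 0)
    (hnd : ∀ x, (∀ y, ω x y = 0) → x = 0)
    (J : V →ₗ[ℝ] V) (hJ : ∀ x, J (J x) = -x)
    (v : V) (hv : v ≠ 0) (hvJ : 0 < ω v (J v)) :
    ∀ x : V, x ≠ 0 → 0 < ω x (J x) := by
  intro x hx
  have hskew : ω (J v) v = -ω v (J v) := (LinearMap.IsAlt.neg halt v (J v)).symm
  have hli : LinearIndependent ℝ ![v, J v] := by
    rw [LinearIndependent.pair_iff]
    intro a b h
    have hb := congrArg (ω v) h
    have ha := congrArg (fun y => ω y (J v)) h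
    simp [halt, hvJ.ne'] at ha hb
    exact ⟨ha, hb⟩
  have : FiniteDimensional ℝ V := .of_finrank_pos (by omega)
  have hspan := hli.span_eq_top_of_card_eq_finrank' (by simp [hdim])
  have hmem : x ∈ Submodule.span ℝ {v, J v} := by
    rw [← Matrix.range_cons_cons_empty, hspan]
    trivial
  obtain ⟨a, b, rfl⟩ := Submodule.mem_span_pair.mp hmem
  have hval : ω (a • v + b • J v) (J (a • v + b • J v)) = (a ^ 2 + b ^ 2) * ω v (J v) := by
    simp [hJ, halt, hskew]
    ring
  have hab : a ≠ 0 ∨ b ≠ 0 := by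
    by_contra! h
    simp [h.1, h.2] at hx
  rw [hval]
  rcases hab with h | h <;> positivity
end

section
/- Let (V, ω) be a finite-dimensional real symplectic vector space. Then the set of ω-tame complex structures on V, topologized as a subspace of the space of linear endomorphisms of V, is nonempty and contractible. -/
/-- A nondegenerate alternating form on a finite-dimensional real vector space admits a compatible
complex structure. -/
theorem exists_compatible_complexStructure {V : Type*} [AddCommGroup V] [Module ℝ V]
    [FiniteDimensional ℝ V] (ω : V →ₗ[ℝ] V →ₗ[ℝ] ℝ)
    (halt : ∀ x, ω x x = 0) (hnd : ∀ x, (∀ y, ω x y = 0) → x = 0) :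
    ∃ J : V →ₗ[ℝ] V, (∀ x, J (J x) = -x) ∧ (∀ x, x ≠ 0 → 0 < ω x (J x)) ∧
      ∀ x y, ω (J x) (J y) = ω x y := by
  induction hn : Module.finrank ℝ V using Nat.strong_induction_on generalizing V with
  | _ n ih =>
  have hskew : ∀ x y, ω x y = -ω y x := fun x y ↦ by
    have h := halt (x + y)
    simp only [map_add, LinearMap.add_apply, halt] at h
    linarith
  by_cases hV : ∀ x : V, x = 0
  · exact ⟨0, fun x ↦ by simp [hV x], fun x hx ↦ absurd (hV x) hx,
      fun x y ↦ by simp [hV x]⟩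
  push Not at hV
  obtain ⟨e, he⟩ := hV
  obtain ⟨f₀, hf₀⟩ : ∃ y, ω e y ≠ 0 := by
    by_contra! h
    exact he (hnd e h)
  obtain ⟨f, hef⟩ : ∃ f, ω e f = 1 := ⟨(ω e f₀)⁻¹ • f₀, by simp [hf₀]⟩
  have hfe : ω f e = -1 := by rw [hskew, hef]
  let W : Submodule ℝ V := LinearMap.ker (ω e) ⊓ LinearMap.ker (ω f)
  have hW : ∀ w : W, ω e w = 0 ∧ ω f w = 0 := fun w ↦ w.2
  have hW' : ∀ w : W, ω w e = 0 ∧ ω w f = 0 := fun w ↦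
    ⟨by rw [hskew, (hW w).1, neg_zero], by rw [hskew, (hW w).2, neg_zero]⟩
  have hlt : Module.finrank ℝ W < n := by
    rw [← hn]
    refine Submodule.finrank_lt fun h ↦ ?_
    have : e ∈ W := h ▸ Submodule.mem_top
    have := this.2
    simp [hfe] at this
  let π₀ : V →ₗ[ℝ] V := LinearMap.id + (ω f).smulRight e - (ω e).smulRight f
  have hπ₀ : ∀ x, π₀ x = x + ω f x • e - ω e x • f := fun x ↦ by simp [π₀]
  let π : V →ₗ[ℝ] W := π₀.codRestrict W fun x ↦ by
    constructor <;> simp [hπ₀, hef, hfe, halt]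
  have hπ : ∀ x, (π x : V) = x + ω f x • e - ω e x • f := hπ₀
  have hdecomp : ∀ x, x = (π x : V) + (ω e x • f - ω f x • e) := fun x ↦ by
    rw [hπ]; abel
  have hπe : π e = 0 := by ext; simp [hπ, hfe, halt]
  have hπf : π f = 0 := by ext; simp [hπ, hef, halt]
  have hπW : ∀ w : W, π w = w := fun w ↦ by ext; simp [hπ, hW w]
  have hform : ∀ x y, ω x y = ω (π x) (π y) + (ω e x * ω f y - ω f x * ω e y) := by
    intro x y
    conv_lhs => rw [hdecomp x, hdecomp y]
    simp [hW, hW', halt, hef, hfe]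
  obtain ⟨K, hK1, hK2, hK3⟩ := ih _ hlt (V := W) (ω.domRestrict₁₂ W W) (fun x ↦ halt x)
    (fun x hx ↦ by
      ext
      refine hnd x fun y ↦ ?_
      rw [hdecomp y]
      have := hx (π y)
      simp only [LinearMap.domRestrict₁₂_apply] at this
      simp [this, hW' x]) rfl
  simp only [LinearMap.domRestrict₁₂_apply] at hK2 hK3
  let J : V →ₗ[ℝ] V := W.subtype ∘ₗ K ∘ₗ π - (ω f).smulRight f - (ω e).smulRight e
  have hJ : ∀ x, J x = K (π x) - ω f x • f - ω e x • e := fun x ↦ by simp [J]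
  have hJe : ∀ x, ω e (J x) = -ω f x := fun x ↦ by simp [hJ, hW, halt, hef]
  have hJf : ∀ x, ω f (J x) = ω e x := fun x ↦ by simp [hJ, hW, halt, hfe]
  have hJπ : ∀ x, π (J x) = K (π x) := fun x ↦ by simp [hJ, hπe, hπf, hπW]
  refine ⟨J, fun x ↦ ?_, fun x hx ↦ ?_, fun x y ↦ ?_⟩
  · rw [hJ, hJπ, hK1, hJe, hJf, Submodule.coe_neg, hπ]
    module
  · rw [hform, hJe, hJf, hJπ]
    by_cases hp : π x = 0
    · have h : ω e x ≠ 0 ∨ ω f x ≠ 0 := by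
        by_contra! h
        apply hx
        rw [hdecomp x, hp, h.1, h.2]
        simp
      rw [hp]
      simp only [map_zero, Submodule.coe_zero]
      rcases h with h | h <;>
        nlinarith [sq_nonneg (ω e x), sq_nonneg (ω f x), sq_pos_of_ne_zero h]
    · have := hK2 _ hp
      nlinarith [sq_nonneg (ω e x), sq_nonneg (ω f x)]
  · rw [hform, hJe, hJf, hJe, hJf, hJπ, hJπ, hK3, hform x y]
    ring

/-- If `P` and `Q` have the same square, and `J * P` and `J * Q` commute, then `P * Q⁻¹ * J` squares
to `-1` as soon as `J` does. -/
theorem mul_inv_mul_sq_eq_neg_one {A : Type*} [Ring A] {P Q R J : A} (hsq : P * P = Q * Q)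
    (hcomm : P * J * Q = Q * J * P) (hJ : J * J = -1) (hRQ : R * Q = 1) (hQR : Q * R = 1) :
    (P * R * J) * (P * R * J) = -1 := by
  have h1 : R * P * J = J * P * R :=
    calc R * P * J = R * (P * J * Q) * R := by simp only [mul_assoc, hQR, mul_one]
      _ = (R * Q) * J * P * R := by rw [hcomm]; simp only [mul_assoc]
      _ = J * P * R := by rw [hRQ, one_mul]
  have h2 : R * R * (Q * Q) = 1 := by
    rw [mul_assoc, ← mul_assoc R Q Q, hRQ, one_mul, hRQ]
  have h3 : Q * Q * (R * R) = 1 := by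
    rw [mul_assoc, ← mul_assoc Q R R, hQR, one_mul, hQR]
  have h4 : P * (R * R) = R * R * P :=
    calc P * (R * R) = R * R * (Q * Q) * P * (R * R) := by rw [h2, one_mul]
      _ = R * R * P * (P * P * (R * R)) := by rw [← hsq]; simp only [mul_assoc]
      _ = R * R * P := by rw [hsq, h3, mul_one]
  calc (P * R * J) * (P * R * J) = P * R * (J * P * R) * J := by simp only [mul_assoc]
    _ = P * (R * R) * P * (J * J) := by rw [← h1]; simp only [mul_assoc]
    _ = -1 := by rw [h4, hJ, mul_assoc (R * R), hsq, h2, one_mul]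

section CayleyPath

variable {V : Type*} [NormedAddCommGroup V] [NormedSpace ℝ V]

/-- The segment between `J` and `K` in the Cayley chart centred at the complex structure `K`. -/
noncomputable def cayleyPath (K : V →L[ℝ] V) (t : ℝ) (J : V →L[ℝ] V) : V →L[ℝ] V :=
  ((2 - t) • J + t • K) * Ring.inverse (t • J + (2 - t) • K) * K

theorem isUnit_smul_add_smul_of_tame [FiniteDimensional ℝ V] {ω : V →ₗ[ℝ] V →ₗ[ℝ] ℝ}
    {J K : V →L[ℝ] V} (hJ : ∀ x, x ≠ 0 → 0 < ω x (J x)) (hK : ∀ x, x ≠ 0 → 0 < ω x (K x))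
    {a b : ℝ} (ha : 0 ≤ a) (hb : 0 < b) : IsUnit (a • J + b • K) := by
  have : CompleteSpace V := FiniteDimensional.complete ℝ V
  have hinj : Function.Injective (a • J + b • K) := by
    rw [injective_iff_map_eq_zero]
    intro x hx
    by_contra hne
    have h : ω x ((a • J + b • K) x) = 0 := by rw [hx, map_zero]
    simp only [add_apply, smul_apply, map_add, map_smul,
      smul_eq_mul] at h
    nlinarith [mul_nonneg ha (hJ x hne).le, mul_pos hb (hK x hne)]
  rw [ContinuousLinearMap.isUnit_iff_bijective]
  exact ⟨hinj, LinearMap.injective_iff_surjective (f := (a • J + b • K).toLinearMap).1 hinj⟩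

theorem cayleyPath_cayleyPath {K J : V →L[ℝ] V} (hK : ∀ x, K (K x) = -x) (hJ : ∀ x, J (J x) = -x)
    {t : ℝ} (hu : IsUnit (t • J + (2 - t) • K)) (x : V) :
    cayleyPath K t J (cayleyPath K t J x) = -x := by
  have hKK : K * K = -1 := by ext x; simp [hK]
  have hJJ : J * J = -1 := by ext x; simp [hJ]
  have hsq : ((2 - t) • J + t • K) * ((2 - t) • J + t • K) =
      (t • J + (2 - t) • K) * (t • J + (2 - t) • K) := by
    simp only [mul_add, add_mul, smul_mul_assoc, mul_smul_comm, hKK, hJJ]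
    module
  have hcomm : ((2 - t) • J + t • K) * K * (t • J + (2 - t) • K) =
      (t • J + (2 - t) • K) * K * ((2 - t) • J + t • K) := by
    simp only [mul_add, add_mul, smul_mul_assoc, mul_smul_comm, mul_assoc, hKK]
    simp only [mul_neg, neg_mul, mul_one, one_mul]
    module
  exact DFunLike.congr_fun (mul_inv_mul_sq_eq_neg_one hsq hcomm hKK
    (Ring.inverse_mul_cancel _ hu) (Ring.mul_inverse_cancel _ hu)) x

theorem cayleyPath_tame {ω : V →ₗ[ℝ] V →ₗ[ℝ] ℝ} (halt : ∀ x, ω x x = 0) {K J : V →L[ℝ] V}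
    (hKK : ∀ x, K (K x) = -x) (hK : ∀ x, x ≠ 0 → 0 < ω x (K x))
    (hKω : ∀ x y, ω (K x) (K y) = ω x y) (hJ : ∀ x, x ≠ 0 → 0 < ω x (J x))
    {t : ℝ} (ht0 : 0 ≤ t) (ht1 : t ≤ 1) (hu : IsUnit (t • J + (2 - t) • K)) {x : V} (hx : x ≠ 0) :
    0 < ω x (cayleyPath K t J x) := by
  obtain ⟨y, hy⟩ : ∃ y, y = Ring.inverse (t • J + (2 - t) • K) (K x) := ⟨_, rfl⟩
  have hQy : t • J y + (2 - t) • K y = K x := by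
    rw [hy]
    exact DFunLike.congr_fun (Ring.mul_inverse_cancel _ hu) (K x)
  have hxy : x = (2 - t) • y - t • K (J y) := by
    rw [← neg_neg x, ← hKK x, ← hQy]
    simp only [map_add, map_smul, hKK]
    module
  have hval : cayleyPath K t J x = (2 - t) • J y + t • K y := by
    rw [hy]; rfl
  have hy0 : y ≠ 0 := by
    rintro rfl
    exact hx (by simpa using hxy)
  have hskew : ∀ u v, ω u v = -ω v u := fun u v ↦ by
    have h := halt (u + v)
    simp only [map_add, LinearMap.add_apply, halt] at h
    linarith
  have hexp : ω x (cayleyPath K t J x) = ((2 - t) ^ 2 + t ^ 2) * ω y (J y) +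
      (2 - t) * t * (ω y (K y) + ω (J y) (K (J y))) := by
    rw [hval, hxy]
    simp only [map_add, map_sub, map_smul, LinearMap.sub_apply, LinearMap.smul_apply, smul_eq_mul,
      hKω, hskew (K (J y)) (J y), hskew (J y) y]
    ring
  have hKJ : 0 ≤ ω (J y) (K (J y)) := by
    by_cases h : J y = 0
    · simp [h]
    · exact (hK _ h).le
  have h2 : 0 < 2 - t := by linarith
  have h1 := hJ y hy0
  have h3 := hK y hy0
  rw [hexp]
  positivity

theorem cayleyPath_zero {K J : V →L[ℝ] V} (hK : ∀ x, K (K x) = -x) : cayleyPath K 0 J = J := by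
  have h : ((2 : ℝ) • K) * (-(2 : ℝ)⁻¹ • K) = 1 := by ext x; simp [hK]
  have h' : (-(2 : ℝ)⁻¹ • K) * ((2 : ℝ) • K) = 1 := by ext x; simp [hK]
  have hinv : Ring.inverse ((2 : ℝ) • K) = -(2 : ℝ)⁻¹ • K :=
    Ring.inverse_unit (⟨_, _, h, h'⟩ : (V →L[ℝ] V)ˣ)
  ext x
  simp [cayleyPath, hinv, hK]

theorem cayleyPath_one {K J : V →L[ℝ] V} (hu : IsUnit ((1 : ℝ) • J + (1 : ℝ) • K)) :
    cayleyPath K 1 J = K := by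
  have h : (2 : ℝ) - 1 = 1 := by norm_num
  rw [cayleyPath, h, Ring.mul_inverse_cancel _ hu, one_mul]

theorem continuous_cayleyPath [FiniteDimensional ℝ V] {X : Type*} [TopologicalSpace X]
    {K : V →L[ℝ] V} {t : X → ℝ} {J : X → V →L[ℝ] V} (ht : Continuous t) (hJ : Continuous J)
    (hu : ∀ x, IsUnit (t x • J x + (2 - t x) • K)) :
    Continuous fun x ↦ cayleyPath K (t x) (J x) := by
  have : CompleteSpace V := FiniteDimensional.complete ℝ V
  have hinv : Continuous fun x ↦ Ring.inverse (t x • J x + (2 - t x) • K) := by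
    refine continuous_iff_continuousAt.2 fun x ↦ ?_
    obtain ⟨u, hux⟩ := hu x
    have hQ : Continuous fun x ↦ t x • J x + (2 - t x) • K := by fun_prop
    exact ContinuousAt.comp_of_eq (NormedRing.inverse_continuousAt u) hQ.continuousAt hux.symm
  have hP : Continuous fun x ↦ (2 - t x) • J x + t x • K := by fun_prop
  exact (hP.mul hinv).mul continuous_const

end CayleyPath


/-- On a finite-dimensional real symplectic vector space `(V, ω)`, the space of
`ω`-tame complex structures (as a subspace of the linear endomorphisms of `V`)
is nonempty and contractible. -/
theorem stmt_10 {V : Type*} [NormedAddCommGroup V] [NormedSpace ℝ V]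
    [FiniteDimensional ℝ V]
    (ω : V →ₗ[ℝ] V →ₗ[ℝ] ℝ)
    (halt : ∀ x, ω x x = 0)
    (hnd : ∀ x, (∀ y, ω x y = 0) → x = 0) :
    Nonempty {J : V →L[ℝ] V // (∀ x, J (J x) = -x) ∧ ∀ x, x ≠ 0 → 0 < ω x (J x)} ∧
    ContractibleSpace
      {J : V →L[ℝ] V // (∀ x, J (J x) = -x) ∧ ∀ x, x ≠ 0 → 0 < ω x (J x)} := by
  obtain ⟨K₀, h1, h2, h3⟩ := exists_compatible_complexStructure ω halt hnd
  obtain ⟨K, hK⟩ : ∃ K : V →L[ℝ] V, ∀ x, K x = K₀ x :=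
    ⟨LinearMap.toContinuousLinearMap K₀, fun _ ↦ rfl⟩
  simp only [← hK] at h1 h2 h3
  refine ⟨⟨K, h1, h2⟩, ?_⟩
  have hu (t : unitInterval)
      (J : {J : V →L[ℝ] V // (∀ x, J (J x) = -x) ∧ ∀ x, x ≠ 0 → 0 < ω x (J x)}) :
      IsUnit ((t : ℝ) • (J : V →L[ℝ] V) + (2 - (t : ℝ)) • K) :=
    isUnit_smul_add_smul_of_tame J.2.2 h2 t.2.1 (by linarith [t.2.2])
  rw [contractible_iff_id_nullhomotopic]
  refine ⟨⟨K, h1, h2⟩, ⟨{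
    toFun := fun p ↦ ⟨cayleyPath K p.1 p.2, cayleyPath_cayleyPath h1 p.2.2.1 (hu p.1 p.2),
      fun x hx ↦ cayleyPath_tame halt h1 h2 h3 p.2.2.2 p.1.2.1 p.1.2.2 (hu p.1 p.2) hx⟩
    continuous_toFun := ?_
    map_zero_left := fun J ↦ Subtype.ext (cayleyPath_zero h1)
    map_one_left := fun J ↦ Subtype.ext (cayleyPath_one ?_) }⟩⟩
  · exact (continuous_cayleyPath (continuous_subtype_val.comp continuous_fst)
      (continuous_subtype_val.comp continuous_snd) fun p ↦ hu p.1 p.2).subtype_mk _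
  · exact isUnit_smul_add_smul_of_tame J.2.2 h2 zero_le_one one_pos
end

section
/- Let E be a 4-dimensional real vector space with a nondegenerate alternating bilinear form ω, and let θ ⊆ E be a symplectic plane. Then the set of ω-tame complex structures J on E satisfying J(θ) ⊆ θ, topologized as a subspace of the space of linear endomorphisms of E, is nonempty and contractible. -/
/-- The Cayley transform `a ↦ (a + b)⁻¹ (a - b)` is inverted by `w ↦ b (1 + w) (1 - w)⁻¹`. -/
lemma inverse_cayley_cayley {R : Type*} [Ring R] {a b : R} (hab : IsUnit (a + b))
    (h : IsUnit (1 - Ring.inverse (a + b) * (a - b))) :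
    b * (1 + Ring.inverse (a + b) * (a - b)) *
      Ring.inverse (1 - Ring.inverse (a + b) * (a - b)) = a := by
  set w := Ring.inverse (a + b) * (a - b) with hw
  have hmul : (a + b) * w = a - b := by
    rw [hw, ← mul_assoc, Ring.mul_inverse_cancel _ hab, one_mul]
  have hcomm : b * (1 + w) = a * (1 - w) := by
    rw [add_mul, ← eq_sub_iff_add_eq'] at hmul
    rw [mul_add, mul_sub, mul_one, mul_one, hmul]
    abel
  rw [hcomm, mul_assoc, Ring.mul_inverse_cancel _ h, mul_one]

section TameComplexStructures

variable {E : Type*} [NormedAddCommGroup E] [NormedSpace ℝ E]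

lemma ContinuousLinearMap.inverse_mul_apply {A : E →L[ℝ] E} (hA : IsUnit A) (x : E) :
    Ring.inverse A (A x) = x :=
  congrArg (fun B : E →L[ℝ] E => B x) (Ring.inverse_mul_cancel A hA)

lemma ContinuousLinearMap.mul_inverse_apply {A : E →L[ℝ] E} (hA : IsUnit A) (x : E) :
    A (Ring.inverse A x) = x :=
  congrArg (fun B : E →L[ℝ] E => B x) (Ring.mul_inverse_cancel A hA)

variable (ω : E →ₗ[ℝ] E →ₗ[ℝ] ℝ) (θ : Submodule ℝ E) (J₀ : E →L[ℝ] E)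

/-- The `ω`-tame complex structures preserving `θ`. -/
def tameComplexStructures : Set (E →L[ℝ] E) :=
  {J | (∀ x, J (J x) = -x) ∧ (∀ x, x ≠ 0 → 0 < ω x (J x)) ∧ ∀ x ∈ θ, J x ∈ θ}

/-- The `J₀`-antilinear maps preserving `θ` that strictly decrease the quadratic form
`x ↦ ω x (J₀ x)`. -/
def antilinearContractions : Set (E →L[ℝ] E) :=
  {W | (∀ x, W (J₀ x) = -J₀ (W x)) ∧ (∀ x, x ≠ 0 → ω (W x) (J₀ (W x)) < ω x (J₀ x)) ∧
    ∀ x ∈ θ, W x ∈ θ}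

variable {ω θ J₀}

lemma starConvex_antilinearContractions (hJ₀ : J₀ ∈ tameComplexStructures ω θ) :
    StarConvex ℝ 0 (antilinearContractions ω θ J₀) := by
  rw [starConvex_zero_iff]
  intro W hW a ha0 ha1
  refine ⟨fun x => ?_, fun x hx => ?_, fun x hx => θ.smul_mem _ (hW.2.2 x hx)⟩
  · simp [hW.1 x]
  · have hnn : 0 ≤ ω (W x) (J₀ (W x)) := by
      by_cases h : W x = 0
      · simp [h]
      · exact (hJ₀.2.1 _ h).le
    have h : a * (a * ω (W x) (J₀ (W x))) ≤ ω (W x) (J₀ (W x)) :=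
      (mul_le_of_le_one_left (mul_nonneg ha0 hnn) ha1).trans (mul_le_of_le_one_left hnn ha1)
    simpa using h.trans_lt (hW.2.1 x hx)

variable [FiniteDimensional ℝ E]

lemma ContinuousLinearMap.isUnit_of_forall_eq_zero (A : E →L[ℝ] E) (h : ∀ x, A x = 0 → x = 0) :
    IsUnit A := by
  have : CompleteSpace E := FiniteDimensional.complete ℝ E
  have hinj : Function.Injective (A : E →ₗ[ℝ] E) :=
    (injective_iff_map_eq_zero (A : E →ₗ[ℝ] E)).2 h
  exact ContinuousLinearMap.isUnit_iff_bijective.2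
    ⟨hinj, LinearMap.injective_iff_surjective.1 hinj⟩

/-- The inverse of an automorphism preserving a finite-dimensional subspace preserves it. -/
lemma ContinuousLinearMap.inverse_mem {A : E →L[ℝ] E} (hA : IsUnit A) {θ : Submodule ℝ E}
    (hθ : ∀ x ∈ θ, A x ∈ θ) {x : E} (hx : x ∈ θ) : Ring.inverse A x ∈ θ := by
  have hinj : Function.Injective ((A : E →ₗ[ℝ] E).restrict hθ) := by
    intro y z hyz
    have h : A y = A z := congrArg Subtype.val hyz
    apply Subtype.ext
    rw [← inverse_mul_apply hA y, h, inverse_mul_apply hA]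
  obtain ⟨y, hy⟩ := LinearMap.injective_iff_surjective.1 hinj ⟨x, hx⟩
  have h : A y = x := congrArg Subtype.val hy
  rw [← h, inverse_mul_apply hA]
  exact y.2

lemma isUnit_add_of_tame {J : E →L[ℝ] E} (hJ₀ : J₀ ∈ tameComplexStructures ω θ)
    (hJ : J ∈ tameComplexStructures ω θ) : IsUnit (J + J₀) := by
  refine ContinuousLinearMap.isUnit_of_forall_eq_zero _ fun x hx => ?_
  by_contra hx0
  have h := congrArg (ω x) hx
  simp only [_root_.add_apply, map_add, map_zero] at h
  linarith [hJ.2.1 x hx0, hJ₀.2.1 x hx0]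

lemma isUnit_one_sub_of_antilinearContraction {W : E →L[ℝ] E}
    (hW : W ∈ antilinearContractions ω θ J₀) : IsUnit (1 - W) := by
  refine ContinuousLinearMap.isUnit_of_forall_eq_zero _ fun x hx => ?_
  by_contra hx0
  have hWx : W x = x := (sub_eq_zero.1 hx).symm
  have h := hW.2.1 x hx0
  rw [hWx] at h
  exact lt_irrefl _ h

/-- The Cayley transform sends tame complex structures to antilinear contractions. -/
lemma cayley_mem (hJ₀ : J₀ ∈ tameComplexStructures ω θ)
    (hsymm : ∀ x y, ω x (J₀ y) = ω y (J₀ x)) {J : E →L[ℝ] E}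
    (hJ : J ∈ tameComplexStructures ω θ) :
    Ring.inverse (J + J₀) * (J - J₀) ∈ antilinearContractions ω θ J₀ := by
  have hU := isUnit_add_of_tame hJ₀ hJ
  set W := Ring.inverse (J + J₀) * (J - J₀)
  have hW : ∀ x, J (W x) + J₀ (W x) = J x - J₀ x := fun x =>
    ContinuousLinearMap.mul_inverse_apply hU ((J - J₀) x)
  have hinj : ∀ x y, J x + J₀ x = J y + J₀ y → x = y := fun x y h => by
    rw [← ContinuousLinearMap.inverse_mul_apply hU x,
      ← ContinuousLinearMap.inverse_mul_apply hU y]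
    exact congrArg _ h
  refine ⟨fun x => hinj _ _ ?_, fun x hx => ?_, fun x hx => ?_⟩
  · rw [hW, map_neg, map_neg, hJ₀.1, hJ₀.1]
    have h := congrArg J (hW x)
    simp only [map_add, map_sub, hJ.1] at h
    rw [neg_add_eq_sub, sub_eq_iff_eq_add] at h
    rw [h]
    abel
  · have hne : x - W x ≠ 0 := fun h => by
      have h' := hW x
      rw [← sub_eq_zero.1 h] at h'
      have h2 : (2 : ℝ) • J₀ x = 0 := by
        rw [two_smul]
        simpa using sub_eq_zero.2 h'
      have h3 : J₀ x = 0 := by simpa using h2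
      exact hx (by simpa [h3] using (hJ₀.1 x).symm)
    have hpos := hJ.2.1 _ hne
    have hJW : J (x - W x) = J₀ (x + W x) := by
      rw [map_sub, map_add, sub_eq_iff_eq_add, add_assoc, add_comm (J₀ (W x)), hW]
      abel
    rw [hJW] at hpos
    simp only [map_sub, map_add, LinearMap.sub_apply] at hpos
    linarith [hsymm x (W x)]
  · refine ContinuousLinearMap.inverse_mem hU (fun y hy => ?_) ?_
    · exact θ.add_mem (hJ.2.2 y hy) (hJ₀.2.2 y hy)
    · exact θ.sub_mem (hJ.2.2 x hx) (hJ₀.2.2 x hx)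

/-- The inverse Cayley transform sends antilinear contractions to tame complex structures. -/
lemma inverse_cayley_mem (hJ₀ : J₀ ∈ tameComplexStructures ω θ)
    (hsymm : ∀ x y, ω x (J₀ y) = ω y (J₀ x)) {W : E →L[ℝ] E}
    (hW : W ∈ antilinearContractions ω θ J₀) :
    J₀ * (1 + W) * Ring.inverse (1 - W) ∈ tameComplexStructures ω θ := by
  have hU := isUnit_one_sub_of_antilinearContraction hW
  set J := J₀ * (1 + W) * Ring.inverse (1 - W)
  have hJ : ∀ y, J (y - W y) = J₀ (y + W y) := fun y =>
    congrArg (fun z => J₀ ((1 + W) z)) (ContinuousLinearMap.inverse_mul_apply hU y)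
  have hsurj : ∀ x, ∃ y, y - W y = x := fun x =>
    ⟨_, ContinuousLinearMap.mul_inverse_apply hU x⟩
  refine ⟨fun x => ?_, fun x hx => ?_, fun x hx => ?_⟩
  · obtain ⟨y, rfl⟩ := hsurj x
    have h : J₀ (y + W y) = J₀ y - W (J₀ y) := by rw [hW.1, map_add, sub_neg_eq_add]
    rw [hJ, h, hJ, hW.1, map_add, map_neg, hJ₀.1, hJ₀.1]
    abel
  · obtain ⟨y, rfl⟩ := hsurj x
    have hy : y ≠ 0 := by
      rintro rfl
      simp at hx
    rw [hJ]
    simp only [map_sub, map_add, LinearMap.sub_apply]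
    linarith [hsymm y (W y), hW.2.1 y hy]
  · have hmem : Ring.inverse (1 - W) x ∈ θ :=
      ContinuousLinearMap.inverse_mem hU (fun y hy => θ.sub_mem hy (hW.2.2 y hy)) hx
    exact hJ₀.2.2 _ (θ.add_mem hmem (hW.2.2 _ hmem))

/-- The space of tame complex structures preserving `θ` is contractible as soon as it has an
`ω`-compatible member. -/
lemma contractibleSpace_tameComplexStructures (hJ₀ : J₀ ∈ tameComplexStructures ω θ)
    (hsymm : ∀ x y, ω x (J₀ y) = ω y (J₀ x)) :
    ContractibleSpace (tameComplexStructures ω θ) := by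
  have : CompleteSpace E := FiniteDimensional.complete ℝ E
  have hzero : (0 : E →L[ℝ] E) ∈ antilinearContractions ω θ J₀ :=
    ⟨by simp, fun x hx => by simpa using hJ₀.2.1 x hx, by simp⟩
  have : ContractibleSpace (antilinearContractions ω θ J₀) :=
    (starConvex_antilinearContractions hJ₀).contractibleSpace ⟨0, hzero⟩
  have hinv : ∀ {A : E →L[ℝ] E}, IsUnit A → ContinuousAt Ring.inverse A := by
    rintro _ ⟨u, rfl⟩
    exact NormedRing.inverse_continuousAt u
  let F : C(tameComplexStructures ω θ, antilinearContractions ω θ J₀) :=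
    ⟨fun J => ⟨_, cayley_mem hJ₀ hsymm J.2⟩, by
      refine Continuous.subtype_mk (Continuous.mul ?_ (by fun_prop)) _
      refine continuous_iff_continuousAt.2 fun J => ?_
      exact ContinuousAt.comp (f := fun J : tameComplexStructures ω θ => (J : E →L[ℝ] E) + J₀)
        (hinv (isUnit_add_of_tame hJ₀ J.2)) (by fun_prop)⟩
  let G : C(antilinearContractions ω θ J₀, tameComplexStructures ω θ) :=
    ⟨fun W => ⟨_, inverse_cayley_mem hJ₀ hsymm W.2⟩, by
      refine Continuous.subtype_mk (Continuous.mul (by fun_prop) ?_) _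
      refine continuous_iff_continuousAt.2 fun W => ?_
      exact ContinuousAt.comp
        (f := fun W : antilinearContractions ω θ J₀ => 1 - (W : E →L[ℝ] E))
        (hinv (isUnit_one_sub_of_antilinearContraction W.2)) (by fun_prop)⟩
  have hGF : G.comp ((ContinuousMap.id _).comp F) = ContinuousMap.id _ := by
    ext1 J
    exact Subtype.ext (inverse_cayley_cayley (isUnit_add_of_tame hJ₀ J.2)
      (isUnit_one_sub_of_antilinearContraction (cayley_mem hJ₀ hsymm J.2)))
  rw [contractible_iff_id_nullhomotopic, ← hGF]
  exact ((id_nullhomotopic (antilinearContractions ω θ J₀)).comp_left F).comp_right G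

/-- A 4-dimensional symplectic space with a symplectic plane `θ` has a symplectic basis
whose first pair spans `θ`. -/
lemma exists_adapted_symplectic_basis (hdim : Module.finrank ℝ E = 4)
    (ω : E →ₗ[ℝ] E →ₗ[ℝ] ℝ) (halt : ∀ x, ω x x = 0)
    (hnd : ∀ x, (∀ y, ω x y = 0) → x = 0)
    (θ : Submodule ℝ E) (hθdim : Module.finrank ℝ θ = 2)
    (hθsymp : ∀ x ∈ θ, x ≠ 0 → ∃ y ∈ θ, ω x y ≠ 0) :
    ∃ e f e' f' : E, e ∈ θ ∧ f ∈ θ ∧ ω e f = 1 ∧ ω e' f' = 1 ∧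
      (∀ x ∈ θ, ω x e' = 0 ∧ ω x f' = 0) ∧
      ∀ x, x = ω x f • e + ω e x • f + ω x f' • e' + ω e' x • f' := by
  have hskew : ∀ x y, ω x y = -ω y x := fun x y => (LinearMap.IsAlt.neg halt y x).symm
  obtain ⟨e, f, he, hf, hef⟩ : ∃ e f : E, e ∈ θ ∧ f ∈ θ ∧ ω e f = 1 := by
    have : Nontrivial θ := Module.nontrivial_of_finrank_pos (R := ℝ) (by omega)
    obtain ⟨⟨x, hx⟩, hx0⟩ := exists_ne (0 : θ)
    obtain ⟨y, hy, hxy⟩ := hθsymp x hx (fun h => hx0 (Subtype.ext h))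
    exact ⟨x, (ω x y)⁻¹ • y, hx, θ.smul_mem _ hy, by simp [hxy]⟩
  have hfe : ω f e = -1 := by rw [hskew, hef]
  have hθ : ∀ x ∈ θ, ∃ a b : ℝ, a • e + b • f = x := by
    intro x hx
    have hli : LinearIndependent ℝ ![(⟨e, he⟩ : θ), ⟨f, hf⟩] := by
      rw [LinearIndependent.pair_iff]
      intro a b hab
      have hab' : a • e + b • f = 0 := congrArg Subtype.val hab
      have h1 := congrArg (ω e) hab'
      have h2 := congrArg (ω f) hab'
      simp [halt, hef, hfe] at h1 h2
      exact ⟨h2, h1⟩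
    have htop := hli.span_eq_top_of_card_eq_finrank (by simp [hθdim])
    have hmem : (⟨x, hx⟩ : θ) ∈ Submodule.span ℝ (Set.range ![(⟨e, he⟩ : θ), ⟨f, hf⟩]) := by
      rw [htop]; trivial
    obtain ⟨c, hc⟩ := (Submodule.mem_span_range_iff_exists_fun ℝ).1 hmem
    rw [Fin.sum_univ_two] at hc
    exact ⟨c 0, c 1, congrArg Subtype.val hc⟩
  obtain ⟨e', he'0, hee', hfe'⟩ : ∃ x : E, x ≠ 0 ∧ ω e x = 0 ∧ ω f x = 0 := by
    have hker := LinearMap.ker_ne_bot_of_finrank_lt (f := (ω e).prod (ω f)) (by simp [hdim])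
    obtain ⟨x, hx, hx0⟩ := Submodule.exists_mem_ne_zero_of_ne_bot hker
    exact ⟨x, hx0, congrArg Prod.fst hx, congrArg Prod.snd hx⟩
  have he'e : ω e' e = 0 := by rw [hskew, hee', neg_zero]
  have he'f : ω e' f = 0 := by rw [hskew, hfe', neg_zero]
  obtain ⟨f', he'f', hef', hff'⟩ : ∃ y : E, ω e' y = 1 ∧ ω e y = 0 ∧ ω f y = 0 := by
    obtain ⟨y, hy⟩ : ∃ y, ω e' y ≠ 0 := by
      by_contra! h
      exact he'0 (hnd _ h)
    refine ⟨(ω e' y)⁻¹ • (y + ω f y • e - ω e y • f), ?_, ?_, ?_⟩ <;>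
      simp [halt, hef, hfe, he'e, he'f, hy]
  have hf'e' : ω f' e' = -1 := by rw [hskew, he'f']
  have hf'e : ω f' e = 0 := by rw [hskew, hef', neg_zero]
  have hf'f : ω f' f = 0 := by rw [hskew, hff', neg_zero]
  refine ⟨e, f, e', f', he, hf, hef, he'f', fun x hx => ?_, fun x => ?_⟩
  · obtain ⟨a, b, rfl⟩ := hθ x hx
    simp [hee', hfe', hef', hff']
  · have hli : LinearIndependent ℝ ![e, f, e', f'] := by
      rw [Fintype.linearIndependent_iff]
      intro c hc
      simp only [Fin.sum_univ_four, Matrix.cons_val] at hc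
      have h1 := congrArg (ω e) hc
      have h2 := congrArg (ω f) hc
      have h3 := congrArg (ω e') hc
      have h4 := congrArg (ω f') hc
      simp [halt, hef, hfe, hee', hfe', he'e, he'f, he'f', hef', hff', hf'e', hf'e, hf'f] at h1 h2 h3 h4
      intro i
      fin_cases i <;> assumption
    have htop := hli.span_eq_top_of_card_eq_finrank (by simp [hdim])
    have hmem : x ∈ Submodule.span ℝ (Set.range ![e, f, e', f']) := by
      rw [htop]; trivial
    obtain ⟨c, hc⟩ := (Submodule.mem_span_range_iff_exists_fun ℝ).1 hmem
    simp only [Fin.sum_univ_four, Matrix.cons_val] at hc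
    rw [← hc]
    simp [halt, hef, hee', he'e, he'f, he'f', hef', hff', hf'f]

/-- There is an `ω`-compatible complex structure preserving a given symplectic plane. -/
lemma exists_compatible_complexStructure_s11 (hdim : Module.finrank ℝ E = 4)
    (ω : E →ₗ[ℝ] E →ₗ[ℝ] ℝ) (halt : ∀ x, ω x x = 0)
    (hnd : ∀ x, (∀ y, ω x y = 0) → x = 0)
    (θ : Submodule ℝ E) (hθdim : Module.finrank ℝ θ = 2)
    (hθsymp : ∀ x ∈ θ, x ≠ 0 → ∃ y ∈ θ, ω x y ≠ 0) :
    ∃ J : E →L[ℝ] E, (∀ x, J (J x) = -x) ∧ (∀ x, x ≠ 0 → 0 < ω x (J x)) ∧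
      (∀ x ∈ θ, J x ∈ θ) ∧ ∀ x y, ω x (J y) = ω y (J x) := by
  have hskew : ∀ x y, ω x y = -ω y x := fun x y => (LinearMap.IsAlt.neg halt y x).symm
  obtain ⟨e, f, e', f', he, hf, hef, he'f', hθ, hx⟩ :=
    exists_adapted_symplectic_basis hdim ω halt hnd θ hθdim hθsymp
  let J : E →ₗ[ℝ] E := (ω.flip f).smulRight f + (ω.flip e).smulRight e +
    (ω.flip f').smulRight f' + (ω.flip e').smulRight e'
  have hJ : ∀ x, J x = ω x f • f + ω x e • e + ω x f' • f' + ω x e' • e' := fun x => rfl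
  have hfe : ω f e = -1 := by rw [hskew, hef]
  have hf'e' : ω f' e' = -1 := by rw [hskew, he'f']
  have h1 := hθ e he
  have h2 := hθ f hf
  have h3 : ω e' e = 0 := by rw [hskew, h1.1, neg_zero]
  have h4 : ω e' f = 0 := by rw [hskew, h2.1, neg_zero]
  have h5 : ω f' e = 0 := by rw [hskew, h1.2, neg_zero]
  have h6 : ω f' f = 0 := by rw [hskew, h2.2, neg_zero]
  refine ⟨LinearMap.toContinuousLinearMap J, fun x => ?_, fun x hx0 => ?_, fun x hxθ => ?_,
    fun x y => ?_⟩ <;> simp only [LinearMap.coe_toContinuousLinearMap']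
  · rw [hJ (J x), hJ x]
    conv_rhs => rw [hx x, hskew e x, hskew e' x]
    simp [halt, hef, hfe, he'f', hf'e', h1, h2, h3, h4, h5, h6]
    abel
  · have hsq : ω x (J x) = ω x f ^ 2 + ω x e ^ 2 + ω x f' ^ 2 + ω x e' ^ 2 := by
      simp [hJ]; ring
    rw [hsq]
    by_contra hle
    have g1 : ω x f = 0 := by nlinarith [sq_nonneg (ω x e), sq_nonneg (ω x f'), sq_nonneg (ω x e')]
    have g2 : ω x e = 0 := by nlinarith [sq_nonneg (ω x f), sq_nonneg (ω x f'), sq_nonneg (ω x e')]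
    have g3 : ω x f' = 0 := by nlinarith [sq_nonneg (ω x e), sq_nonneg (ω x f), sq_nonneg (ω x e')]
    have g4 : ω x e' = 0 := by nlinarith [sq_nonneg (ω x e), sq_nonneg (ω x f'), sq_nonneg (ω x f)]
    apply hx0
    rw [hx x, hskew e x, hskew e' x, g1, g2, g3, g4]
    simp
  · rw [hJ, (hθ x hxθ).1, (hθ x hxθ).2, zero_smul, zero_smul, add_zero, add_zero]
    exact θ.add_mem (θ.smul_mem _ hf) (θ.smul_mem _ he)
  · simp [hJ]; ring

end TameComplexStructures

/-- Let `(E, ω)` be a 4-dimensional real symplectic vector space and `θ ⊆ E` a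
symplectic plane. The space of `ω`-tame complex structures on `E` preserving `θ`
(as a subspace of the linear endomorphisms of `E`) is nonempty and contractible. -/
theorem stmt_11 {E : Type*} [NormedAddCommGroup E] [NormedSpace ℝ E]
    [FiniteDimensional ℝ E] (hdim : Module.finrank ℝ E = 4)
    (ω : E →ₗ[ℝ] E →ₗ[ℝ] ℝ)
    (halt : ∀ x, ω x x = 0)
    (hnd : ∀ x, (∀ y, ω x y = 0) → x = 0)
    (θ : Submodule ℝ E) (hθdim : Module.finrank ℝ θ = 2)
    (hθsymp : ∀ x ∈ θ, x ≠ 0 → ∃ y ∈ θ, ω x y ≠ 0) :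
    Nonempty {J : E →L[ℝ] E // (∀ x, J (J x) = -x) ∧
        (∀ x, x ≠ 0 → 0 < ω x (J x)) ∧ ∀ x ∈ θ, J x ∈ θ} ∧
    ContractibleSpace {J : E →L[ℝ] E // (∀ x, J (J x) = -x) ∧
        (∀ x, x ≠ 0 → 0 < ω x (J x)) ∧ ∀ x ∈ θ, J x ∈ θ} := by
  obtain ⟨J₀, hsq, htame, hmem, hsymm⟩ :=
    exists_compatible_complexStructure_s11 hdim ω halt hnd θ hθdim hθsymp
  have hJ₀ : J₀ ∈ tameComplexStructures ω θ := ⟨hsq, htame, hmem⟩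
  exact ⟨⟨⟨J₀, hJ₀⟩⟩, contractibleSpace_tameComplexStructures hJ₀ hsymm⟩
end
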